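/- arXiv:2303.12954 — 6 statements merged into one kernel-verified Lean document; each statement's English description precedes it below -/
import Mathlib

section
/- Let t, s ∈ ℝ with t² ≤ s². Then the differential operator T = 1 + t·∂_{z_1} − t·∂_{z_2} − s²·∂_{z_1}∂_{z_2} on ℂ[z_1,…,z_m] preserves stability: if p ∈ ℂ[z_1,…,z_m] (m ≥ 2) is stable, then T(p) is stable. -/
/-- A polynomial `p ∈ ℂ[z_1,…,z_m]` is stable if it has no zero with all
coordinates in the open upper half plane. -/
def MvStable {σ : Type*} (p : MvPolynomial σ ℂ) : Prop :=
  ∀ z : σ → ℂ, (∀ i, 0 < (z i).im) → MvPolynomial.eval z p ≠ 0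

open Polynomial in
/-- The logarithmic derivative of a polynomial without zeros in the upper half plane maps it to the
closed lower half plane. -/
theorem im_logDeriv_nonpos (u : ℂ[X]) (hu : ∀ x : ℂ, 0 < x.im → u.eval x ≠ 0) {x : ℂ}
    (hx : 0 < x.im) :
    (u.derivative.eval x / u.eval x).im ≤ 0 ∧
      ((u.derivative.eval x / u.eval x).im = 0 → u.derivative.eval x = 0) := by
  rw [(IsAlgClosed.splits u).eval_derivative_div_eval_of_ne_zero (hu x hx)]
  have hroot : ∀ r ∈ u.roots, r.im ≤ 0 := fun r hr => by
    by_contra! h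
    exact hu r h (Polynomial.isRoot_of_mem_roots hr)
  have hterm : ∀ r ∈ u.roots, (1 / (x - r)).im < 0 := fun r hr => by
    have h1 : 0 < (x - r).im := by
      have := hroot r hr
      rw [Complex.sub_im]; linarith
    have h2 : x - r ≠ 0 := fun h => by simp [h] at h1
    rw [one_div, Complex.inv_im]
    exact div_neg_of_neg_of_pos (by linarith) (Complex.normSq_pos.2 h2)
  have him : ∀ m : Multiset ℂ, m.sum.im = (m.map Complex.im).sum := fun m =>
    map_multiset_sum Complex.imAddGroupHom m
  rw [him, Multiset.map_map]
  by_cases h0 : u.roots = 0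
  · have hd : u.degree = 0 := by
      by_contra h
      obtain ⟨r, hr⟩ := IsAlgClosed.exists_root u h
      have hu0 : u ≠ 0 := fun h => hu x hx (by simp [h])
      simpa [h0] using (Polynomial.mem_roots hu0).2 hr
    rw [Polynomial.eq_C_of_degree_eq_zero hd]
    simp
  · have hlt : (u.roots.map (Complex.im ∘ fun r => 1 / (x - r))).sum < 0 := by
      simpa using Multiset.sum_lt_sum_of_nonempty (g := fun _ => (0 : ℝ)) h0 hterm
    exact ⟨hlt.le, fun h => absurd h hlt.ne⟩

namespace MvPolynomial

variable {σ : Type*} [DecidableEq σ]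

/-- The univariate polynomial obtained from `p` by freezing all variables but the `i`-th at the
coordinates of `z`. -/
noncomputable def slice (z : σ → ℂ) (i : σ) (p : MvPolynomial σ ℂ) : Polynomial ℂ :=
  aeval (Function.update (fun k => Polynomial.C (z k)) i Polynomial.X) p

theorem eval_slice (z : σ → ℂ) (i : σ) (p : MvPolynomial σ ℂ) (x : ℂ) :
    (slice z i p).eval x = eval (Function.update z i x) p := by
  induction p using MvPolynomial.induction_on with
  | C a => simp [slice]
  | add p q hp hq => simp_all [slice]
  | mul_X p k hp =>
    by_cases h : k = i
    · subst h; simp_all [slice]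
    · simp_all [slice]

theorem derivative_slice (z : σ → ℂ) (i : σ) (p : MvPolynomial σ ℂ) :
    (slice z i p).derivative = slice z i (pderiv i p) := by
  induction p using MvPolynomial.induction_on with
  | C a => simp [slice]
  | add p q hp hq => simp_all [slice]
  | mul_X p k hp =>
    by_cases h : k = i
    · subst h; simp_all [slice]; ring
    · simp_all [slice, mul_comm]

end MvPolynomial

section Stable

open MvPolynomial

variable {σ : Type*} [DecidableEq σ] {p : MvPolynomial σ ℂ} {z : σ → ℂ}

theorem update_im_pos (hz : ∀ k, 0 < (z k).im) (i : σ) {x : ℂ} (hx : 0 < x.im) (k : σ) :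
    0 < (Function.update z i x k).im := by
  by_cases h : k = i
  · subst h; simpa using hx
  · simpa [h] using hz k

/-- Along a coordinate line on which `p` has no zeros in the upper half plane, the logarithmic
derivative of `p` takes values in the closed lower half plane. -/
theorem im_pderiv_div_nonpos (i : σ)
    (hp : ∀ x : ℂ, 0 < x.im → eval (Function.update z i x) p ≠ 0) (hz : ∀ k, 0 < (z k).im) :
    (eval z (pderiv i p) / eval z p).im ≤ 0 ∧
      ((eval z (pderiv i p) / eval z p).im = 0 → eval z (pderiv i p) = 0) := by
  have := im_logDeriv_nonpos (slice z i p) (fun x hx => by rw [eval_slice]; exact hp x hx) (hz i)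
  simpa [derivative_slice, eval_slice] using this

/-- If a partial derivative of a stable polynomial vanishes at a point of the upper half space, it
vanishes along each coordinate line through that point. -/
theorem MvStable.slice_pderiv_eq_zero (hp : MvStable p) (i j : σ) (hz : ∀ k, 0 < (z k).im)
    (h0 : eval z (pderiv j p) = 0) : slice z i (pderiv j p) = 0 := by
  let h : ℂ → ℂ := fun x => (slice z i (pderiv j p)).eval x / (slice z i p).eval x
  have hne : (slice z i p).eval (z i) ≠ 0 := by
    simpa [eval_slice] using hp z hz
  have han : AnalyticAt ℂ h (z i) :=
    ((slice z i (pderiv j p)).differentiable.analyticAt _).div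
      ((slice z i p).differentiable.analyticAt _) hne
  have hzero : h (z i) = 0 := by simp [h, eval_slice, h0]
  have hpos : ∀ᶠ x in nhds (z i), 0 < x.im :=
    (isOpen_lt continuous_const Complex.continuous_im).mem_nhds (hz i)
  rcases han.eventually_constant_or_nhds_le_map_nhds with hc | hle
  · rw [hzero] at hc
    have hev : ∀ᶠ x in nhds (z i), (slice z i (pderiv j p)).IsRoot x := by
      filter_upwards [hc, hpos] with x hx hxpos
      have hx' : (slice z i p).eval x ≠ 0 := by
        rw [eval_slice]; exact hp _ (update_im_pos hz i hxpos)
      exact (div_eq_zero_iff.1 hx).resolve_right hx'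
    exact Polynomial.eq_zero_of_infinite_isRoot _ (infinite_of_mem_nhds (z i) hev)
  · exfalso
    have hev : ∀ᶠ y in nhds (h (z i)), y.im ≤ 0 := by
      refine hle (Filter.mem_map.2 ?_)
      filter_upwards [hpos] with x hx
      have hw := update_im_pos hz i hx
      have := (im_pderiv_div_nonpos j (fun y hy => hp _ (update_im_pos hw j hy)) hw).1
      simpa [h, eval_slice] using this
    rw [hzero] at hev
    have hlim : Filter.Tendsto (fun r : ℝ => (r : ℂ) * Complex.I) (nhdsWithin 0 (Set.Ioi 0))
        (nhds 0) := by
      have : Continuous fun r : ℝ => (r : ℂ) * Complex.I := by fun_prop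
      simpa using (this.tendsto 0).mono_left nhdsWithin_le_nhds
    obtain ⟨r, hr, hr'⟩ := ((hlim.eventually hev).and self_mem_nhdsWithin).exists
    simp only [Complex.mul_I_im, Complex.ofReal_re] at hr
    exact hr.not_gt hr'

theorem im_moebius_nonneg {t s : ℝ} (hts : t ^ 2 ≤ s ^ 2) {r : ℂ} (hr : r.im ≤ 0) :
    0 ≤ ((1 + t * r) / (t + s ^ 2 * r)).im := by
  have h : ((1 + t * r) / (t + s ^ 2 * r)).im
      = (t ^ 2 - s ^ 2) * r.im / Complex.normSq (t + s ^ 2 * r) := by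
    rw [Complex.div_im]
    simp [← Complex.ofReal_pow]
    ring
  rw [h]
  exact div_nonneg (mul_nonneg_of_nonpos_of_nonpos (by linarith) hr) (Complex.normSq_nonneg _)

theorem MvStable.mixed_second_order (hp : MvStable p) {t s : ℝ} (hts : t ^ 2 ≤ s ^ 2) (i j : σ) :
    MvStable (p + (t : ℂ) • pderiv i p - (t : ℂ) • pderiv j p
      - ((s : ℂ) ^ 2) • pderiv i (pderiv j p)) := by
  intro z hz hT
  have hline : ∀ w : σ → ℂ, (∀ k, 0 < (w k).im) → ∀ k x, 0 < x.im →
      eval (Function.update w k x) p ≠ 0 := fun w hw k x hx => hp _ (update_im_pos hw k hx)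
  have hpz := hp z hz
  have hlog := im_pderiv_div_nonpos j (hline z hz j) hz
  simp only [map_add, map_sub, smul_eval] at hT
  by_cases hs : s = 0
  · have ht : t = 0 := by subst hs; nlinarith
    subst hs ht
    simp [hpz] at hT
  have hs2 : (s : ℂ) ^ 2 ≠ 0 := by simpa using hs
  by_cases hdeg : t = 0 ∧ eval z (pderiv j p) = 0
  · have h2 : eval z (pderiv i (pderiv j p)) = 0 := by
      have := congrArg (fun q => q.derivative.eval (z i)) (hp.slice_pderiv_eq_zero i j hz hdeg.2)
      simpa [derivative_slice, eval_slice] using this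
    simp [hdeg.1, h2, hpz] at hT
  set f : MvPolynomial σ ℂ := ((-t : ℝ) : ℂ) • p + ((s : ℂ) ^ 2) • pderiv j p with hf
  have hfne : ∀ x : ℂ, 0 < x.im → eval (Function.update z i x) f ≠ 0 := by
    intro x hx h
    set w := Function.update z i x with hwdef
    have hw := update_im_pos hz i hx
    rw [← hwdef] at hw
    have hpw := hp w hw
    simp only [hf, map_add, smul_eval] at h
    have hr : eval w (pderiv j p) / eval w p = ((t / s ^ 2 : ℝ) : ℂ) := by
      rw [div_eq_iff hpw]
      push_cast at h ⊢
      rw [div_mul_eq_mul_div, eq_div_iff hs2]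
      linear_combination h
    have h1 : eval w (pderiv j p) = 0 :=
      (im_pderiv_div_nonpos j (hline w hw j) hw).2 (by rw [hr, Complex.ofReal_im])
    have ht : t = 0 := by simpa [h1, hpw] using h
    have h2 := hp.slice_pderiv_eq_zero i j hw h1
    refine hdeg ⟨ht, ?_⟩
    have := congrArg (fun q => q.eval (z i)) h2
    simpa [eval_slice, hwdef] using this
  have hflog := im_pderiv_div_nonpos i hfne hz
  set r := eval z (pderiv j p) / eval z p with hr
  have hpj : eval z (pderiv j p) = r * eval z p := by rw [hr, div_mul_cancel₀ _ hpz]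
  have hfr : eval z f = (((-t : ℝ) : ℂ) + (s : ℂ) ^ 2 * r) * eval z p := by
    simp only [hf, map_add, smul_eval, hpj]
    ring
  have hfi : eval z (pderiv i f) = (1 + ((-t : ℝ) : ℂ) * r) * eval z p := by
    simp only [hf, map_add, Derivation.map_smul_of_tower, smul_eval]
    rw [hpj] at hT
    push_cast
    linear_combination -hT
  have hmob := im_moebius_nonneg (t := -t) (s := s) (by simpa using hts) hlog.1
  rw [← mul_div_mul_right _ _ hpz, ← hfi, ← hfr] at hmob
  have hzero := hflog.2 (le_antisymm hflog.1 hmob)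
  have h1 : (1 : ℂ) + ((-t : ℝ) : ℂ) * r = 0 := by
    rw [hfi] at hzero
    exact (mul_eq_zero.1 hzero).resolve_right hpz
  have him : -t * r.im = 0 := by simpa using congrArg Complex.im h1
  rcases mul_eq_zero.1 him with ht | him
  · simp [ht] at h1
  · have : r = 0 := by rw [hr, hlog.2 him, zero_div]
    simp [this] at h1

end Stable

/-- the operator `1 + t∂_{z_1} − t∂_{z_2} − s²∂_{z_1}∂_{z_2}` preserves
stability when `t² ≤ s²` (Lemma `spd`(ii)). -/
theorem statement5 {m : ℕ} (hm : 2 ≤ m) (t s : ℝ) (hts : t ^ 2 ≤ s ^ 2)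
    (p : MvPolynomial (Fin m) ℂ) (hp : MvStable p) :
    MvStable (p + (t : ℂ) • MvPolynomial.pderiv (⟨0, by omega⟩ : Fin m) p
      - (t : ℂ) • MvPolynomial.pderiv (⟨1, by omega⟩ : Fin m) p
      - ((s : ℂ) ^ 2) • MvPolynomial.pderiv (⟨0, by omega⟩ : Fin m)
          (MvPolynomial.pderiv (⟨1, by omega⟩ : Fin m) p)) := by
  exact hp.mixed_second_order hts _ _
end

section
/- If ε_1,…,ε_m ∈ ℝ and A_1,…,A_m are d×d positive semidefinite hermitian matrices, then the mixed characteristic polynomial μ[ε_1 A_1,…,ε_m A_m] is a monic polynomial of degree d all of whose roots are real. -/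
open scoped ComplexOrder

/-- The mixed characteristic polynomial
`μ[A_1,…,A_m](x) = ∏ (1 − ∂_{z_i}) det(x I + Σ z_i A_i) |_{z=0}`. -/
noncomputable def mixedCharPoly {m d : ℕ} (A : Fin m → Matrix (Fin d) (Fin d) ℂ) :
    Polynomial ℂ :=
  MvPolynomial.eval (fun _ => (0 : Polynomial ℂ))
    ((List.ofFn fun i : Fin m =>
        ((1 : Module.End (Polynomial ℂ) (MvPolynomial (Fin m) (Polynomial ℂ))) -
          (MvPolynomial.pderiv i).toLinearMap :
          Module.End (Polynomial ℂ) (MvPolynomial (Fin m) (Polynomial ℂ)))).prod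
      (Matrix.det (Matrix.of fun a b =>
        MvPolynomial.C Polynomial.X * (if a = b then 1 else 0) +
          ∑ i, MvPolynomial.X i * MvPolynomial.C (Polynomial.C (A i a b)))))

namespace mixedCharPoly

open MvPolynomial

/-- If every root `r` of `f` satisfies `c * r.im < 0`, then so does every root of `f - derivative f`. -/
theorem eval_sub_derivative_ne_zero (c : ℝ) (f : Polynomial ℂ)
    (hf : ∀ z : ℂ, 0 ≤ c * z.im → f.eval z ≠ 0) (z : ℂ) (hz : 0 ≤ c * z.im) :
    (f - Polynomial.derivative f).eval z ≠ 0 := by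
  intro h
  have hfz := hf z hz
  have hsum : (f.roots.map fun r => 1 / (z - r)).sum = 1 := by
    rw [← (IsAlgClosed.splits f).eval_derivative_div_eval_of_ne_zero hfz]
    rw [Polynomial.eval_sub, sub_eq_zero] at h
    rw [← h, div_self hfz]
  have hneg : ∀ r ∈ f.roots, c * (1 / (z - r)).im < 0 := by
    intro r hr
    have hr' : c * r.im < 0 := by
      by_contra! hcon
      exact hf r hcon (Polynomial.isRoot_of_mem_roots hr)
    have hne : z - r ≠ 0 := by
      intro h0
      rw [sub_eq_zero.mp h0] at hz
      exact absurd hz (not_le.mpr hr')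
    rw [one_div, Complex.inv_im, mul_div_assoc']
    refine div_neg_of_neg_of_pos ?_ (Complex.normSq_pos.mpr hne)
    rw [Complex.sub_im]
    linarith
  have him : (f.roots.map fun r => c * (1 / (z - r)).im).sum = 0 := by
    have := congrArg (fun w : ℂ => c * w.im) hsum
    simp only [Complex.one_im, mul_zero] at this
    rw [← this, Multiset.sum_map_mul_left]
    congr 1
    rw [← Complex.imCLM_apply, map_multiset_sum, Multiset.map_map]
    rfl
  rcases Multiset.empty_or_exists_mem f.roots with h0 | ⟨r, hr⟩
  · simp [h0] at hsum
  · obtain ⟨t, ht⟩ := Multiset.exists_cons_of_mem hr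
    have hle : (t.map fun r => c * (1 / (z - r)).im).sum ≤ 0 := by
      refine (Multiset.sum_le_card_nsmul _ 0 fun x hx => ?_).trans (smul_zero _).le
      obtain ⟨a, ha, rfl⟩ := Multiset.mem_map.mp hx
      exact (hneg a (ht ▸ Multiset.mem_cons_of_mem ha)).le
    rw [ht, Multiset.map_cons, Multiset.sum_cons] at him
    linarith [hneg r hr]

/-- Restricting to the `i`-th coordinate line turns `∂_i` into the univariate derivative. -/
theorem derivative_aeval_update {m : ℕ} (z : Fin m → ℂ) (i : Fin m)
    (q : MvPolynomial (Fin m) ℂ) :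
    Polynomial.derivative (aeval (Function.update (fun j => Polynomial.C (z j)) i Polynomial.X) q) =
      aeval (Function.update (fun j => Polynomial.C (z j)) i Polynomial.X) (pderiv i q) := by
  induction q using MvPolynomial.induction_on with
  | C a => simp
  | add p q hp hq => simp [hp, hq]
  | mul_X p j hp =>
    rw [map_mul, Polynomial.derivative_mul, hp, Derivation.leibniz, pderiv_X]
    rcases eq_or_ne j i with rfl | hj
    · simp; ring
    · simp [hj, Pi.single_eq_of_ne]; ring

theorem eval_aeval_update {m : ℕ} (z : Fin m → ℂ) (i : Fin m) (q : MvPolynomial (Fin m) ℂ)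
    (t : ℂ) :
    (aeval (Function.update (fun j => Polynomial.C (z j)) i Polynomial.X) q).eval t =
      eval (Function.update z i t) q := by
  induction q using MvPolynomial.induction_on with
  | C a => simp
  | add p q hp hq => simp [hp, hq]
  | mul_X p j hp =>
    rw [map_mul, Polynomial.eval_mul, hp, map_mul]
    rcases eq_or_ne j i with rfl | hj
    · simp
    · simp [hj]

theorem eval_sub_pderiv_ne_zero {m : ℕ} (c : Fin m → ℝ) (i : Fin m) (q : MvPolynomial (Fin m) ℂ)
    (hq : ∀ z : Fin m → ℂ, (∀ j, 0 ≤ c j * (z j).im) → eval z q ≠ 0)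
    (z : Fin m → ℂ) (hz : ∀ j, 0 ≤ c j * (z j).im) :
    eval z (q - pderiv i q) ≠ 0 := by
  have key := eval_sub_derivative_ne_zero (c i)
    (aeval (Function.update (fun j => Polynomial.C (z j)) i Polynomial.X) q) ?_ (z i) (hz i)
  · rwa [derivative_aeval_update, ← map_sub, eval_aeval_update, Function.update_eq_self] at key
  · intro t ht
    rw [eval_aeval_update]
    refine hq _ fun j => ?_
    rcases eq_or_ne j i with rfl | hj
    · simpa using ht
    · simpa [hj] using hz j

/-- A property preserved by each `1 - ∂_i` is preserved by their product. -/
theorem prod_one_sub_pderiv_induction {m : ℕ} {R : Type*} [CommRing R]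
    (P : MvPolynomial (Fin m) R → Prop) (hP : ∀ i q, P q → P (q - pderiv i q))
    (q : MvPolynomial (Fin m) R) (hq : P q) :
    P ((List.ofFn fun i : Fin m =>
        ((1 : Module.End R (MvPolynomial (Fin m) R)) -
          (pderiv i).toLinearMap : Module.End R (MvPolynomial (Fin m) R))).prod q) := by
  refine List.prod_induction (p := fun T : Module.End R (MvPolynomial (Fin m) R) =>
    ∀ q, P q → P (T q)) ?_ ?_ ?_ q hq
  · intro S T hS hT q hq
    exact hS _ (hT _ hq)
  · intro q hq
    exact hq
  · intro T hT q hq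
    obtain ⟨i, rfl⟩ := (List.mem_ofFn' _ _).mp hT
    exact hP i q hq

open Matrix in
theorem det_smul_one_add_sum_ne_zero {m d : ℕ} (ε : Fin m → ℝ)
    (A : Fin m → Matrix (Fin d) (Fin d) ℂ) (hA : ∀ i, (A i).PosSemidef) (w : ℂ) (hw : w.im ≠ 0)
    (z : Fin m → ℂ) (hz : ∀ i, 0 ≤ w.im * ε i * (z i).im) :
    (w • (1 : Matrix (Fin d) (Fin d) ℂ) + ∑ i, (z i * ε i) • A i).det ≠ 0 := by
  intro h
  obtain ⟨v, hv, hv0⟩ := Matrix.exists_mulVec_eq_zero_iff.mpr h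
  have hnorm : 0 < star v ⬝ᵥ v := Matrix.dotProduct_star_self_pos_iff.mpr hv
  have hquad : w * (star v ⬝ᵥ v) + ∑ i, (z i * ε i) * (star v ⬝ᵥ (A i *ᵥ v)) = 0 := by
    have := congrArg (fun u => star v ⬝ᵥ u) hv0
    simpa [Matrix.add_mulVec, Matrix.sum_mulVec, Matrix.smul_mulVec, dotProduct_add,
      dotProduct_sum, dotProduct_smul] using this
  have him := congrArg (fun u : ℂ => w.im * u.im) hquad
  simp only [Complex.add_im, Complex.im_sum, Complex.zero_im, mul_zero, mul_add,
    Finset.mul_sum] at him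
  have hpos : 0 < w.im * (w * (star v ⬝ᵥ v)).im := by
    obtain ⟨h1, h2⟩ := Complex.pos_iff.mp hnorm
    rw [Complex.mul_im, ← h2, mul_zero, zero_add, ← mul_assoc]
    exact mul_pos (mul_self_pos.mpr hw) h1
  have hnonneg : 0 ≤ ∑ i, w.im * (z i * ε i * (star v ⬝ᵥ (A i *ᵥ v))).im := by
    refine Finset.sum_nonneg fun i _ => ?_
    obtain ⟨h1, h2⟩ := Complex.nonneg_iff.mp ((hA i).dotProduct_mulVec_nonneg v)
    have : w.im * (z i * ε i * (star v ⬝ᵥ (A i *ᵥ v))).im =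
        w.im * ε i * (z i).im * (star v ⬝ᵥ (A i *ᵥ v)).re := by
      rw [Complex.mul_im, ← h2, Complex.im_mul_ofReal]
      ring
    rw [this]
    exact mul_nonneg (hz i) h1
  linarith

/-- The total degree in `x` and the `z_i` together is at most `n`. -/
def JointDegreeLE {m : ℕ} (n : ℕ) (q : MvPolynomial (Fin m) (Polynomial ℂ)) : Prop :=
  ∀ (s : Fin m →₀ ℕ) (k : ℕ), (q.coeff s).coeff k ≠ 0 → k + s.degree ≤ n

namespace JointDegreeLE

variable {m : ℕ}

theorem add {n : ℕ} {p q : MvPolynomial (Fin m) (Polynomial ℂ)} (hp : JointDegreeLE n p)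
    (hq : JointDegreeLE n q) : JointDegreeLE n (p + q) := by
  intro s k h
  by_contra hlt
  refine h ?_
  rw [coeff_add, Polynomial.coeff_add, not_imp_comm.mp (hp s k) hlt,
    not_imp_comm.mp (hq s k) hlt, add_zero]

theorem zero (n : ℕ) : JointDegreeLE n (0 : MvPolynomial (Fin m) (Polynomial ℂ)) := by
  intro s k h
  simp at h

theorem sum {ι : Type*} (t : Finset ι) {n : ℕ} (f : ι → MvPolynomial (Fin m) (Polynomial ℂ))
    (hf : ∀ i ∈ t, JointDegreeLE n (f i)) : JointDegreeLE n (∑ i ∈ t, f i) :=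
  Finset.sum_induction f (JointDegreeLE n) (fun _ _ => add) (zero n) hf

theorem mul {n l : ℕ} {p q : MvPolynomial (Fin m) (Polynomial ℂ)} (hp : JointDegreeLE n p)
    (hq : JointDegreeLE l q) : JointDegreeLE (n + l) (p * q) := by
  intro s k h
  rw [coeff_mul, Polynomial.finsetSum_coeff] at h
  obtain ⟨⟨a, b⟩, hab, h⟩ := Finset.exists_ne_zero_of_sum_ne_zero h
  rw [Polynomial.coeff_mul] at h
  obtain ⟨⟨i, j⟩, hij, h⟩ := Finset.exists_ne_zero_of_sum_ne_zero h
  have h1 := hp a i (left_ne_zero_of_mul h)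
  have h2 := hq b j (right_ne_zero_of_mul h)
  rw [Finset.HasAntidiagonal.mem_antidiagonal] at hab hij
  simp only at hab hij
  rw [← hab, ← hij, map_add]
  omega

theorem C_C (a : ℂ) :
    JointDegreeLE 0 (C (Polynomial.C a) : MvPolynomial (Fin m) (Polynomial ℂ)) := by
  intro s k h
  rw [coeff_C] at h
  split_ifs at h with hs
  · rw [Polynomial.coeff_C] at h
    split_ifs at h with hk
    · simp [← hs, hk]
    · exact absurd rfl h
  · simp at h

theorem C_X : JointDegreeLE 1 (C Polynomial.X : MvPolynomial (Fin m) (Polynomial ℂ)) := by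
  intro s k h
  rw [coeff_C] at h
  split_ifs at h with hs
  · rw [Polynomial.coeff_X] at h
    split_ifs at h with hk
    · simp [← hs, ← hk]
    · exact absurd rfl h
  · simp at h

theorem X (i : Fin m) : JointDegreeLE 1 (X i : MvPolynomial (Fin m) (Polynomial ℂ)) := by
  intro s k h
  rw [coeff_X] at h
  split_ifs at h with hs
  · rw [Polynomial.coeff_one] at h
    split_ifs at h with hk
    · simp [← hs, hk]
    · exact absurd rfl h
  · simp at h

theorem prod {ι : Type*} (t : Finset ι) (f : ι → MvPolynomial (Fin m) (Polynomial ℂ))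
    (hf : ∀ i ∈ t, JointDegreeLE 1 (f i)) : JointDegreeLE t.card (∏ i ∈ t, f i) := by
  classical
  induction t using Finset.induction_on with
  | empty => simpa using C_C (m := m) 1
  | insert a t ha ih =>
    rw [Finset.prod_insert ha, Finset.card_insert_of_notMem ha, add_comm]
    exact (hf a (Finset.mem_insert_self a t)).mul
      (ih fun i hi => hf i (Finset.mem_insert_of_mem hi))

theorem det {d : ℕ} (M : Matrix (Fin d) (Fin d) (MvPolynomial (Fin m) (Polynomial ℂ)))
    (hM : ∀ a b, JointDegreeLE 1 (M a b)) : JointDegreeLE d M.det := by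
  rw [Matrix.det_apply']
  refine sum _ _ fun σ _ => ?_
  have h1 := prod Finset.univ (fun i => M (σ i) i) fun i _ => hM _ _
  have h2 := (C_C (m := m) ((Equiv.Perm.sign σ : ℤ) : ℂ)).mul h1
  simpa using h2

theorem sub_pderiv {n : ℕ} {q : MvPolynomial (Fin m) (Polynomial ℂ)} (hq : JointDegreeLE n q)
    (i : Fin m) : JointDegreeLE n (q - pderiv i q) := by
  rw [sub_eq_add_neg]
  refine hq.add fun s k h => ?_
  rw [coeff_neg, Polynomial.coeff_neg, neg_ne_zero, coeff_pderiv] at h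
  have h' : (q.coeff (s + Finsupp.single i 1)).coeff k ≠ 0 := by
    intro h0
    apply h
    rw [← Nat.cast_add_one, ← Polynomial.C_eq_natCast, Polynomial.coeff_mul_C, h0, zero_mul]
  have := hq _ k h'
  rw [map_add] at this
  omega

end JointDegreeLE

/-- The operator `1 - ∂_i` does not change the top coefficient in `x`. -/
theorem coeff_sub_pderiv {m : ℕ} {n : ℕ} {q : MvPolynomial (Fin m) (Polynomial ℂ)}
    (hq : JointDegreeLE n q) (i : Fin m) :
    ((q - pderiv i q).coeff 0).coeff n = (q.coeff 0).coeff n := by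
  rw [coeff_sub, Polynomial.coeff_sub, coeff_pderiv, sub_eq_self]
  have h0 : (q.coeff (Finsupp.single i 1)).coeff n = 0 := by
    by_contra h
    simpa using hq _ n h
  simp [h0]

end mixedCharPoly

open mixedCharPoly in
/-- `μ[ε_1 A_1,…,ε_m A_m]` is a monic real-rooted polynomial of degree `d`
for real `ε_i` and positive semidefinite `A_i` (Lemma `crs`). -/
theorem statement6 {m d : ℕ} (ε : Fin m → ℝ) (A : Fin m → Matrix (Fin d) (Fin d) ℂ)
    (hA : ∀ i, (A i).PosSemidef) :
    (mixedCharPoly fun i => (ε i : ℂ) • A i).Monic ∧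
    (mixedCharPoly fun i => (ε i : ℂ) • A i).natDegree = d ∧
    ∀ z : ℂ, (mixedCharPoly fun i => (ε i : ℂ) • A i).IsRoot z → z.im = 0 := by
  set A' : Fin m → Matrix (Fin d) (Fin d) ℂ := fun i => (ε i : ℂ) • A i with hA'
  set M : Matrix (Fin d) (Fin d) (MvPolynomial (Fin m) (Polynomial ℂ)) :=
    Matrix.of fun a b =>
      MvPolynomial.C Polynomial.X * (if a = b then 1 else 0) +
        ∑ i, MvPolynomial.X i * MvPolynomial.C (Polynomial.C (A' i a b)) with hM
  have hdeg : JointDegreeLE d M.det := by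
    refine JointDegreeLE.det _ fun a b => ?_
    refine JointDegreeLE.add ?_ (JointDegreeLE.sum _ _ fun i _ =>
      (JointDegreeLE.X i).mul (JointDegreeLE.C_C _))
    split_ifs
    · simpa using JointDegreeLE.C_X
    · simpa using JointDegreeLE.zero 1
  have hlead : (M.det.coeff 0).coeff d = 1 := by
    have h : M.det.coeff 0 = Polynomial.X ^ d := by
      rw [← MvPolynomial.constantCoeff_eq, RingHom.map_det]
      have : MvPolynomial.constantCoeff.mapMatrix M =
          (Polynomial.X : Polynomial ℂ) • (1 : Matrix (Fin d) (Fin d) (Polynomial ℂ)) := by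
        ext1 a b
        simp only [hM, RingHom.mapMatrix_apply, Matrix.map_apply, Matrix.of_apply, map_add,
          map_mul, map_sum, MvPolynomial.constantCoeff_X, MvPolynomial.constantCoeff_C, zero_mul,
          Finset.sum_const_zero, add_zero, Matrix.smul_apply, Matrix.one_apply, smul_eq_mul]
        split_ifs <;> simp
      rw [this, Matrix.det_smul, Matrix.det_one, Fintype.card_fin, mul_one]
    rw [h, Polynomial.coeff_X_pow_self]
  have hfinal := prod_one_sub_pderiv_induction
    (fun q => JointDegreeLE d q ∧ (q.coeff 0).coeff d = 1)
    (fun i q hq => ⟨hq.1.sub_pderiv i, (coeff_sub_pderiv hq.1 i).trans hq.2⟩) _ ⟨hdeg, hlead⟩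
  have hμ : mixedCharPoly A' = ((List.ofFn fun i : Fin m =>
        ((1 : Module.End (Polynomial ℂ) (MvPolynomial (Fin m) (Polynomial ℂ))) -
          (MvPolynomial.pderiv i).toLinearMap :
          Module.End (Polynomial ℂ) (MvPolynomial (Fin m) (Polynomial ℂ)))).prod M.det).coeff 0 := by
    rw [← MvPolynomial.constantCoeff_eq, ← MvPolynomial.eval_zero']
    rfl
  have hle : (mixedCharPoly A').natDegree ≤ d := by
    rw [hμ, Polynomial.natDegree_le_iff_coeff_eq_zero]
    intro k hk
    by_contra h
    have := hfinal.1 0 k h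
    simp only [map_zero] at this
    omega
  have hcoeff : (mixedCharPoly A').coeff d = 1 := by
    rw [hμ]
    exact hfinal.2
  refine ⟨Polynomial.monic_of_natDegree_le_of_coeff_eq_one d hle hcoeff,
    le_antisymm hle (Polynomial.le_natDegree_of_ne_zero (by simp [hcoeff])), ?_⟩
  intro w hroot
  by_contra hw
  have hstable := prod_one_sub_pderiv_induction
    (fun q => ∀ z : Fin m → ℂ, (∀ i, 0 ≤ w.im * ε i * (z i).im) →
      MvPolynomial.eval z (MvPolynomial.map (Polynomial.evalRingHom w) q) ≠ 0)
    (fun i q hq => by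
      rw [map_sub, ← MvPolynomial.pderiv_map]
      exact eval_sub_pderiv_ne_zero (fun i => w.im * ε i) i _ hq)
    M.det (by
      intro z hz
      rw [RingHom.map_det, RingHom.map_det]
      convert det_smul_one_add_sum_ne_zero ε A hA w hw z hz using 2
      ext1 a b
      simp only [hM, hA', RingHom.mapMatrix_apply, Matrix.map_apply, Matrix.of_apply, map_add,
        map_mul, map_sum, MvPolynomial.map_C, MvPolynomial.map_X, MvPolynomial.eval_C,
        MvPolynomial.eval_X, Polynomial.coe_evalRingHom, Polynomial.eval_X, Polynomial.eval_C,
        Matrix.add_apply, Matrix.smul_apply, Matrix.sum_apply, Matrix.one_apply, smul_eq_mul,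
        mul_assoc]
      split_ifs <;> simp)
  refine hstable 0 (by simp) ?_
  rw [MvPolynomial.eval_zero, MvPolynomial.constantCoeff_map]
  rw [hμ] at hroot
  exact hroot
end

section
/- Let S_1,…,S_m be finite sets, d ∈ ℕ, and for each (s_1,…,s_m) ∈ S_1 × … × S_m let f_{s_1,…,s_m} ∈ ℝ[x] be a monic real-rooted polynomial of degree d. Assume the family is interlacing: for every choice of independent random variables ξ_1,…,ξ_m taking values in S_1,…,S_m respectively, the polynomial E[f_{ξ_1,…,ξ_m}] is real-rooted. Then for any such ξ_1,…,ξ_m there exists an outcome (s_1,…,s_m) ∈ S_1 × … × S_m with P(ξ_i = s_i) > 0 for all i such that maxroot(f_{s_1,…,s_m}) ≤ maxroot(E[f_{ξ_1,…,ξ_m}]); likewise there exists an outcome (s_1',…,s_m') with P(ξ_i = s_i') > 0 for all i such that maxroot(f_{s_1',…,s_m'}) ≥ maxroot(E[f_{ξ_1,…,ξ_m}]). -/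
/-- A real polynomial is real-rooted if all of its complex roots are real. -/
def RealRootedR (p : Polynomial ℝ) : Prop :=
  ∀ z : ℂ, Polynomial.aeval z p = 0 → z.im = 0

/-- The largest real root of a polynomial. -/
noncomputable def maxRootR (p : Polynomial ℝ) : ℝ :=
  sSup {x : ℝ | p.IsRoot x}

open Polynomial

theorem RealRootedR.splits {p : ℝ[X]} (hp : RealRootedR p) : p.Splits := by
  refine Splits.of_splits_map (algebraMap ℝ ℂ) (IsAlgClosed.splits _) fun z hz => ?_
  have him := hp z (by simpa [aeval_def, eval_map] using (mem_roots'.1 hz).2)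
  exact ⟨z.re, Complex.ext (by simp) (by simp [him])⟩

theorem isGreatest_maxRootR {p : ℝ[X]} (hp : RealRootedR p) (hm : p.Monic)
    (hd : p.natDegree ≠ 0) : IsGreatest {x : ℝ | p.IsRoot x} (maxRootR p) := by
  have hfin : {x : ℝ | p.IsRoot x}.Finite := finite_setOfPred_isRoot hm.ne_zero
  have hne : {x : ℝ | p.IsRoot x}.Nonempty := by
    refine hp.splits.exists_eval_eq_zero fun h => hd ?_
    exact natDegree_eq_of_degree_eq_some h
  exact ⟨hne.csSup_mem hfin, fun x hx => le_csSup hfin.bddAbove hx⟩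

/-- A monic polynomial that splits over `ℝ` is positive to the right of all its roots. -/
theorem eval_pos_of_forall_root_lt {p : ℝ[X]} (hp : p.Splits) (hm : p.Monic) {x : ℝ}
    (hx : ∀ y, p.IsRoot y → y < x) : 0 < p.eval x := by
  rw [hp.eval_eq_prod_roots_of_monic hm]
  refine Multiset.prod_induction (fun y : ℝ => 0 < y) _ (fun _ _ => mul_pos) one_pos ?_
  intro a ha
  obtain ⟨y, hy, rfl⟩ := Multiset.mem_map.1 ha
  exact sub_pos.2 (hx y (mem_roots'.1 hy).2)

/-- A monic polynomial that splits over `ℝ` and is small at `x` has a root close to `x`. -/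
theorem exists_root_abs_sub_lt {p : ℝ[X]} (hp : p.Splits) (hm : p.Monic) {x ε : ℝ}
    (hε : 0 < ε) (hx : |p.eval x| < ε ^ p.natDegree) : ∃ y, p.IsRoot y ∧ |x - y| < ε := by
  by_contra! h
  refine hx.not_ge ?_
  rw [hp.eval_eq_prod_roots_of_monic hm, hp.natDegree_eq_card_roots]
  have hroots : ∀ y ∈ p.roots, ε ≤ |x - y| := fun y hy => h y (mem_roots'.1 hy).2
  generalize p.roots = r at hroots
  induction r using Multiset.induction_on with
  | empty => simp
  | cons a s ih =>
    rw [Multiset.map_cons, Multiset.prod_cons, Multiset.card_cons, pow_succ', abs_mul]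
    exact mul_le_mul (hroots a (Multiset.mem_cons_self a s))
      (ih fun y hy => hroots y (Multiset.mem_cons_of_mem hy)) (by positivity) (abs_nonneg _)

/-- Let `f` and `g` be monic of the same degree, both positive at `c`, such that every convex
combination of them splits over `ℝ`. If `f` has a root above `c`, then so does `g`. -/
theorem exists_root_gt_of_convexCombination {d : ℕ} {f g : ℝ[X]} {c : ℝ}
    (hm : ∀ t ∈ Set.Icc (0 : ℝ) 1, ((1 - t) • f + t • g).Monic)
    (hd : ∀ t ∈ Set.Icc (0 : ℝ) 1, ((1 - t) • f + t • g).natDegree = d)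
    (hs : ∀ t ∈ Set.Icc (0 : ℝ) 1, ((1 - t) • f + t • g).Splits)
    (hfc : 0 < f.eval c) (hgc : 0 < g.eval c) (hf : ∃ x, c < x ∧ f.IsRoot x) :
    ∃ x, c < x ∧ g.IsRoot x := by
  have hf1 : f.Monic := by simpa using hm 0 (by simp)
  have hf2 : f.Splits := by simpa using hs 0 (by simp)
  have hg1 : g.Monic := by simpa using hm 1 (by simp)
  have hg2 : g.Splits := by simpa using hs 1 (by simp)
  have hpos : ∀ t ∈ Set.Icc (0 : ℝ) 1, ∀ a b : ℝ, 0 < a → 0 < b → 0 < (1 - t) * a + t * b := by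
    intro t ht a b ha hb
    rcases ht.1.eq_or_lt with rfl | h
    · simpa
    · have := mul_nonneg (sub_nonneg.2 ht.2) ha.le
      have := mul_pos h hb
      linarith
  obtain ⟨B₁, hB₁⟩ := (finite_setOfPred_isRoot hf1.ne_zero).bddAbove
  obtain ⟨B₂, hB₂⟩ := (finite_setOfPred_isRoot hg1.ne_zero).bddAbove
  set B := max B₁ B₂
  have hB : ∀ t ∈ Set.Icc (0 : ℝ) 1, ∀ x, (1 - t) * f.eval x + t * g.eval x = 0 → x ≤ B := by
    intro t ht x hx
    by_contra! h
    refine (hpos t ht _ _ (eval_pos_of_forall_root_lt hf2 hf1 fun y hy => ?_)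
      (eval_pos_of_forall_root_lt hg2 hg1 fun y hy => ?_)).ne' hx
    · exact ((hB₁ hy).trans (le_max_left _ _)).trans_lt h
    · exact ((hB₂ hy).trans (le_max_right _ _)).trans_lt h
  set A : Set ℝ := {t | ∃ x, c < x ∧ (1 - t) * f.eval x + t * g.eval x = 0}
  have hAimage : A ∩ Set.Icc 0 1 = Prod.fst '' ((Set.Icc (0 : ℝ) 1 ×ˢ Set.Icc c B) ∩
      {q : ℝ × ℝ | (1 - q.1) * f.eval q.2 + q.1 * g.eval q.2 = 0}) := by
    ext t
    constructor
    · rintro ⟨⟨x, hcx, hx⟩, ht⟩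
      exact ⟨(t, x), ⟨⟨ht, hcx.le, hB t ht x hx⟩, hx⟩, rfl⟩
    · rintro ⟨⟨t, x⟩, ⟨⟨ht, hx⟩, h0⟩, rfl⟩
      refine ⟨⟨x, hx.1.lt_of_ne ?_, h0⟩, ht⟩
      rintro rfl
      exact (hpos t ht _ _ hfc hgc).ne' h0
  have hAclosed : IsClosed (A ∩ Set.Icc 0 1) := by
    rw [hAimage]
    refine (((isCompact_Icc.prod isCompact_Icc).inter_right ?_).image continuous_fst).isClosed
    exact isClosed_eq (by fun_prop) continuous_const
  have hsub : Set.Icc (0 : ℝ) 1 ⊆ A := by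
    refine hAclosed.Icc_subset_of_forall_mem_nhdsWithin ?_ ?_
    · obtain ⟨x, hcx, hx⟩ := hf
      exact ⟨x, hcx, by simpa using hx⟩
    · rintro t ⟨⟨x, hcx, hx⟩, ht⟩
      have hε : 0 < x - c := sub_pos.2 hcx
      have hcont : Continuous fun u : ℝ => |(1 - u) * f.eval x + u * g.eval x| := by fun_prop
      have hsmall : ∀ᶠ u in nhdsWithin t (Set.Ioi t),
          |(1 - u) * f.eval x + u * g.eval x| < (x - c) ^ d := by
        refine Filter.Eventually.filter_mono nhdsWithin_le_nhds
          (hcont.continuousAt.eventually_lt continuousAt_const ?_)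
        rw [hx, abs_zero]
        positivity
      filter_upwards [hsmall, Ioo_mem_nhdsGT ht.2] with u hu hut
      have hu01 : u ∈ Set.Icc (0 : ℝ) 1 := ⟨ht.1.trans hut.1.le, hut.2.le⟩
      obtain ⟨y, hy, hxy⟩ := exists_root_abs_sub_lt (hs u hu01) (hm u hu01) hε
        (x := x) (by simpa [hd u hu01] using hu)
      refine ⟨y, ?_, by simpa using hy⟩
      linarith [(abs_lt.1 hxy).2]
  obtain ⟨x, hcx, hx⟩ := hsub (Set.right_mem_Icc.2 zero_le_one)
  exact ⟨x, hcx, by simpa using hx⟩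

section ExpectedPolynomial

variable {ι : Type*} [Fintype ι] [DecidableEq ι] {S : ι → Type*} [∀ i, Fintype (S i)]

/-- The expectation of `f` under the product of the distributions `w i`. -/
noncomputable def expectedPolynomial (f : (∀ i, S i) → ℝ[X]) (w : ∀ i, S i → ℝ) : ℝ[X] :=
  ∑ s : ∀ i, S i, (∏ i, w i (s i)) • f s

theorem sum_prod_eq_one {w : ∀ i, S i → ℝ} (hw1 : ∀ i, ∑ x, w i x = 1) :
    ∑ s : ∀ i, S i, ∏ i, w i (s i) = 1 := by
  rw [← Fintype.prod_sum]
  simp [hw1]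

theorem expectedPolynomial_monic_and_natDegree_eq {d : ℕ} {f : (∀ i, S i) → ℝ[X]}
    (hmonic : ∀ s, (f s).Monic) (hdeg : ∀ s, (f s).natDegree = d) {w : ∀ i, S i → ℝ}
    (hw1 : ∀ i, ∑ x, w i x = 1) :
    (expectedPolynomial f w).Monic ∧ (expectedPolynomial f w).natDegree = d := by
  have hle : (expectedPolynomial f w).natDegree ≤ d :=
    natDegree_sum_le_of_forall_le _ _ fun s _ => (natDegree_smul_le _ _).trans (hdeg s).le
  have hcoeff : (expectedPolynomial f w).coeff d = 1 := by
    have h : ∀ s, (f s).coeff d = 1 := fun s => by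
      rw [← hdeg s]
      exact hmonic s
    simp [expectedPolynomial, h, sum_prod_eq_one hw1]
  exact ⟨monic_of_natDegree_le_of_coeff_eq_one d hle hcoeff,
    natDegree_eq_of_le_of_coeff_ne_zero hle (by simp [hcoeff])⟩

theorem expectedPolynomial_update (f : (∀ i, S i) → ℝ[X]) (w : ∀ i, S i → ℝ) (i : ι)
    (v : S i → ℝ) : expectedPolynomial f (Function.update w i v) =
      ∑ s : ∀ i, S i, (v (s i) * ∏ j ∈ Finset.univ.erase i, w j (s j)) • f s := by
  refine Finset.sum_congr rfl fun s _ => ?_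
  rw [← Finset.mul_prod_erase _ _ (Finset.mem_univ i), Function.update_self]
  congr 2
  refine Finset.prod_congr rfl fun j hj => ?_
  rw [Function.update_of_ne (Finset.ne_of_mem_erase hj)]

theorem expectedPolynomial_update_convexCombination (f : (∀ i, S i) → ℝ[X])
    (w : ∀ i, S i → ℝ) (i : ι) (a b : ℝ) (u v : S i → ℝ) :
    expectedPolynomial f (Function.update w i (a • u + b • v)) =
      a • expectedPolynomial f (Function.update w i u) +
        b • expectedPolynomial f (Function.update w i v) := by
  simp only [expectedPolynomial_update, Finset.smul_sum, ← Finset.sum_add_distrib, smul_smul,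
    ← add_smul]
  refine Finset.sum_congr rfl fun s _ => ?_
  congr 1
  simp only [Pi.add_apply, Pi.smul_apply, smul_eq_mul]
  ring

/-- The law of total expectation, conditioning on the `i`-th coordinate. -/
theorem expectedPolynomial_eq_sum_update_single [∀ i, DecidableEq (S i)]
    (f : (∀ i, S i) → ℝ[X]) (w : ∀ i, S i → ℝ) (i : ι) :
    expectedPolynomial f w =
      ∑ x, w i x • expectedPolynomial f (Function.update w i (Pi.single x 1)) := by
  conv_lhs => rw [← Function.update_eq_self i w]
  simp only [expectedPolynomial_update, Finset.smul_sum, smul_smul]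
  rw [Finset.sum_comm]
  refine Finset.sum_congr rfl fun s _ => ?_
  rw [← Finset.sum_smul]
  simp [Pi.single_apply]

theorem expectedPolynomial_single [∀ i, DecidableEq (S i)] (f : (∀ i, S i) → ℝ[X])
    (s : ∀ i, S i) : expectedPolynomial f (fun i => Pi.single (s i) 1) = f s := by
  rw [expectedPolynomial, Finset.sum_eq_single s]
  · simp
  · intro t _ hts
    obtain ⟨i, hi⟩ := Function.ne_iff.1 hts
    rw [Finset.prod_eq_zero (Finset.mem_univ i) (by simp [hi]), zero_smul]
  · simp

/-- In an interlacing family, if the expected polynomial is positive at `c`, then some outcome of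
positive probability is such that the expected polynomial has a root above `c` as soon as that
outcome does. -/
theorem exists_outcome_root_gt_imp [∀ i, DecidableEq (S i)] {d : ℕ}
    {f : (∀ i, S i) → ℝ[X]} (hmonic : ∀ s, (f s).Monic) (hdeg : ∀ s, (f s).natDegree = d)
    (hinterlacing : ∀ w : ∀ i, S i → ℝ, (∀ i x, 0 ≤ w i x) → (∀ i, ∑ x, w i x = 1) →
      RealRootedR (expectedPolynomial f w)) {c : ℝ} (T : Finset ι) (w : ∀ i, S i → ℝ)
    (hw0 : ∀ i x, 0 ≤ w i x) (hw1 : ∀ i, ∑ x, w i x = 1)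
    (hT : ∀ i ∉ T, ∃ x, w i = Pi.single x 1) (hc : 0 < (expectedPolynomial f w).eval c) :
    ∃ s : ∀ i, S i, (∀ i, 0 < w i (s i)) ∧ ((∃ x, c < x ∧ (f s).IsRoot x) →
      ∃ x, c < x ∧ (expectedPolynomial f w).IsRoot x) := by
  induction T using Finset.induction_on generalizing w with
  | empty =>
    choose s hs using fun i => hT i (Finset.notMem_empty i)
    obtain rfl : w = fun i => Pi.single (s i) 1 := funext hs
    exact ⟨s, by simp, by simp [expectedPolynomial_single]⟩
  | insert i T hi ih =>
    have hex : ∃ x, 0 < w i x ∧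
        0 < (expectedPolynomial f (Function.update w i (Pi.single x 1))).eval c := by
      rw [expectedPolynomial_eq_sum_update_single f w i, eval_finsetSum] at hc
      simp only [eval_smul, smul_eq_mul] at hc
      obtain ⟨x, -, hx⟩ := Finset.exists_lt_of_sum_lt (f := fun _ => (0 : ℝ)) (by simpa using hc)
      exact ⟨x, (pos_and_pos_or_neg_and_neg_of_mul_pos hx).resolve_right
        fun h => h.1.not_ge (hw0 i x)⟩
    obtain ⟨x, hwx, hxc⟩ := hex
    have hupd0 : ∀ v : S i → ℝ, (∀ y, 0 ≤ v y) → ∀ j y, 0 ≤ Function.update w i v j y := by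
      intro v hv j
      rcases eq_or_ne j i with rfl | hj
      · simpa using hv
      · simpa [hj] using hw0 j
    have hupd1 : ∀ v : S i → ℝ, ∑ y, v y = 1 → ∀ j, ∑ y, Function.update w i v j y = 1 := by
      intro v hv j
      rcases eq_or_ne j i with rfl | hj
      · simpa using hv
      · simpa [hj] using hw1 j
    have hsingle : ∀ y, 0 ≤ (Pi.single x 1 : S i → ℝ) y := 
      (Pi.single_nonneg.2 (zero_le_one' ℝ) : (0 : S i → ℝ) ≤ Pi.single x 1)
    obtain ⟨s, hs, hroot⟩ := ih (Function.update w i (Pi.single x 1)) (hupd0 _ hsingle)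
      (hupd1 _ (by simp)) (fun j hj => by
        rcases eq_or_ne j i with rfl | hji
        · exact ⟨x, by simp⟩
        · simpa [hji] using hT j (by simp [hji, hj])) hxc
    refine ⟨s, fun j => ?_, fun hfs => ?_⟩
    · rcases eq_or_ne j i with rfl | hj
      · have := hs j
        rw [Function.update_self] at this
        rcases eq_or_ne (s j) x with h | h
        · rwa [h]
        · simp [h] at this
      · simpa [hj] using hs j
    · have hpath : ∀ t : ℝ, (1 - t) • expectedPolynomial f (Function.update w i (Pi.single x 1)) +
          t • expectedPolynomial f w =
          expectedPolynomial f (Function.update w i ((1 - t) • Pi.single x 1 + t • w i)) := by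
        intro t
        rw [expectedPolynomial_update_convexCombination, Function.update_eq_self]
      have h0 : ∀ t ∈ Set.Icc (0 : ℝ) 1, ∀ y,
          0 ≤ ((1 - t) • (Pi.single x 1 : S i → ℝ) + t • w i) y := fun t ht y =>
        add_nonneg (mul_nonneg (sub_nonneg.2 ht.2) (hsingle y)) (mul_nonneg ht.1 (hw0 i y))
      have h1 : ∀ t : ℝ, ∑ y, ((1 - t) • (Pi.single x 1 : S i → ℝ) + t • w i) y = 1 := by
        intro t
        simp only [Pi.add_apply, Pi.smul_apply, smul_eq_mul, Finset.sum_add_distrib,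
          ← Finset.mul_sum, hw1]
        simp
      have hmd := fun t => expectedPolynomial_monic_and_natDegree_eq hmonic hdeg
        (hupd1 _ (h1 t))
      refine exists_root_gt_of_convexCombination (d := d) ?_ ?_ ?_ hxc hc (hroot hfs) <;>
        intro t ht <;> rw [hpath]
      · exact (hmd t).1
      · exact (hmd t).2
      · exact (hinterlacing _ (hupd0 _ (h0 t ht)) (hupd1 _ (h1 t))).splits

end ExpectedPolynomial

/-- for an interlacing family, some member has its largest root at most
(resp. at least) the largest root of the expected polynomial (Theorem `maxint`).
Independent finitely-valued random variables `ξ_i` with values in `S i` are encoded by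
their probability mass functions `w i`; the expectation `E[f_{ξ_1,…,ξ_m}]` is then
`∑_s (∏ i, w i (s i)) • f s`. -/
theorem statement7 {m d : ℕ} (S : Fin m → Type*) [∀ i, Fintype (S i)] [∀ i, Nonempty (S i)]
    (f : (∀ i, S i) → Polynomial ℝ)
    (hmonic : ∀ s, (f s).Monic)
    (hdeg : ∀ s, (f s).natDegree = d)
    (hroots : ∀ s, RealRootedR (f s))
    (hinterlacing : ∀ w : ∀ i, S i → ℝ, (∀ i x, 0 ≤ w i x) → (∀ i, ∑ x, w i x = 1) →
      RealRootedR (∑ s : ∀ i, S i, (∏ i, w i (s i)) • f s))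
    (w : ∀ i, S i → ℝ) (hw0 : ∀ i x, 0 ≤ w i x) (hw1 : ∀ i, ∑ x, w i x = 1) :
    (∃ s : ∀ i, S i, (∀ i, 0 < w i (s i)) ∧
      maxRootR (f s) ≤ maxRootR (∑ s' : ∀ i, S i, (∏ i, w i (s' i)) • f s')) ∧
    (∃ s : ∀ i, S i, (∀ i, 0 < w i (s i)) ∧
      maxRootR (∑ s' : ∀ i, S i, (∏ i, w i (s' i)) • f s') ≤ maxRootR (f s)) := by
  classical
  change (∃ s : ∀ i, S i, (∀ i, 0 < w i (s i)) ∧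
      maxRootR (f s) ≤ maxRootR (expectedPolynomial f w)) ∧
    (∃ s : ∀ i, S i, (∀ i, 0 < w i (s i)) ∧
      maxRootR (expectedPolynomial f w) ≤ maxRootR (f s))
  have hrr := hinterlacing w hw0 hw1
  change RealRootedR (expectedPolynomial f w) at hrr
  obtain ⟨hm, hd⟩ := expectedPolynomial_monic_and_natDegree_eq hmonic hdeg hw1
  rcases eq_or_ne d 0 with rfl | hd0
  · have hex : ∀ i, ∃ x, 0 < w i x := fun i => by
      obtain ⟨x, -, hx⟩ := Finset.exists_lt_of_sum_lt (s := Finset.univ) (f := fun _ => (0 : ℝ))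
        (g := w i) (by simp [hw1])
      exact ⟨x, hx⟩
    choose s hs using hex
    have heq : f s = expectedPolynomial f w := by
      rw [(hmonic s).natDegree_eq_zero.1 (hdeg s), hm.natDegree_eq_zero.1 hd]
    exact ⟨⟨s, hs, by rw [heq]⟩, s, hs, by rw [heq]⟩
  have hM := isGreatest_maxRootR hrr hm (hd ▸ hd0)
  have hMs := fun s => isGreatest_maxRootR (hroots s) (hmonic s) (hdeg s ▸ hd0)
  set M := maxRootR (expectedPolynomial f w)
  refine ⟨?_, ?_⟩
  · by_contra! hcon
    have hc : ∃ c, M < c ∧ ∀ s : ∀ i, S i, (∀ i, 0 < w i (s i)) → c < maxRootR (f s) := by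
      have hev : ∀ᶠ c in nhdsWithin M (Set.Ioi M), ∀ s : ∀ i, S i, (∀ i, 0 < w i (s i)) →
          c < maxRootR (f s) := by
        refine Filter.eventually_all.2 fun s => ?_
        by_cases hs : ∀ i, 0 < w i (s i)
        · filter_upwards [Ioo_mem_nhdsGT (hcon s hs)] with c hc _ using hc.2
        · exact Filter.Eventually.of_forall fun c h => absurd h hs
      obtain ⟨c, hc, hMc⟩ := (hev.and self_mem_nhdsWithin).exists
      exact ⟨c, hMc, hc⟩
    obtain ⟨c, hMc, hc⟩ := hc
    obtain ⟨s, hs, hroot⟩ := exists_outcome_root_gt_imp hmonic hdeg hinterlacing Finset.univ w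
      hw0 hw1 (by simp) (eval_pos_of_forall_root_lt hrr.splits hm
        fun y hy => (hM.2 hy).trans_lt hMc)
    obtain ⟨x, hcx, hx⟩ := hroot ⟨_, hc s hs, (hMs s).1⟩
    exact ((hM.2 hx).trans_lt hMc).not_gt hcx
  · by_contra! hcon
    have hnn : ∀ s : ∀ i, S i, 0 ≤ ∏ i, w i (s i) := fun s =>
      Finset.prod_nonneg fun i _ => hw0 i (s i)
    have hposof : ∀ s : ∀ i, S i, 0 < ∏ i, w i (s i) → 0 < (f s).eval M := by
      intro s hs
      refine eval_pos_of_forall_root_lt (hroots s).splits (hmonic s) fun y hy =>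
        ((hMs s).2 hy).trans_lt (hcon s fun i => (hw0 i _).lt_of_ne' fun h => hs.ne' ?_)
      exact Finset.prod_eq_zero (Finset.mem_univ i) h
    have hpos : 0 < (expectedPolynomial f w).eval M := by
      rw [expectedPolynomial, eval_finsetSum]
      obtain ⟨s, -, hs⟩ := Finset.exists_lt_of_sum_lt (s := Finset.univ) (f := fun _ => (0 : ℝ))
        (g := fun s : ∀ i, S i => ∏ i, w i (s i)) (by simp [sum_prod_eq_one hw1])
      refine Finset.sum_pos' (fun t _ => ?_) ⟨s, Finset.mem_univ s, ?_⟩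
      · rw [eval_smul, smul_eq_mul]
        rcases (hnn t).eq_or_lt with h | h
        · simp [← h]
        · exact (mul_pos h (hposof t h)).le
      · rw [eval_smul, smul_eq_mul]
        exact mul_pos hs (hposof s hs)
    exact hpos.ne' hM.1
end

section
/- Let A_1,…,A_m be d×d positive semidefinite matrices and S_1,…,S_m finite subsets of ℝ. For (ε_1,…,ε_m) ∈ S_1 × … × S_m define f_{ε_1,…,ε_m}(x) = μ[ε_1 A_1,…,ε_m A_m](x) · μ[−ε_1 A_1,…,−ε_m A_m](x). Then this family is an interlacing family: each f_{ε_1,…,ε_m} is a monic real-rooted polynomial of degree 2d, and for every choice of independent random variables ξ_1,…,ξ_m taking values in S_1,…,S_m respectively, the polynomial E[f_{ξ_1,…,ξ_m}] is real-rooted. -/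
open scoped ComplexOrder

/-- A polynomial (with complex coefficients) is real-rooted if all its roots are real. -/
def RealRooted (p : Polynomial ℂ) : Prop := ∀ z : ℂ, p.IsRoot z → z.im = 0

/-- A univariate polynomial without roots in the closed half-plane `0 ≤ σ * im t` satisfies
`G + u G' ≠ 0` there, for every `u` in that half-plane. -/
theorem Polynomial.eval_add_mul_derivative_ne_zero {σ : ℝ} {G : Polynomial ℂ}
    (hG : ∀ t : ℂ, 0 ≤ σ * t.im → G.eval t ≠ 0) {t u : ℂ} (ht : 0 ≤ σ * t.im)
    (hu : 0 ≤ σ * u.im) : G.eval t + u * G.derivative.eval t ≠ 0 := by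
  intro h
  have hGt := hG t ht
  have hlog := (IsAlgClosed.splits G).eval_derivative_div_eval_of_ne_zero hGt
  set q : ℂ := G.derivative.eval t / G.eval t with hq
  have huq : u * q = -1 := by
    rw [hq]; field_simp; linear_combination h
  have hu0 : u ≠ 0 := by rintro rfl; simp at huq
  have hqu : q = -u⁻¹ := by field_simp; linear_combination huq
  have him : 0 ≤ σ * q.im := by
    rw [hqu, Complex.neg_im, Complex.inv_im]
    have : σ * -(-u.im / Complex.normSq u) = σ * u.im / Complex.normSq u := by ring
    rw [this]
    exact div_nonneg hu (Complex.normSq_nonneg _)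
  have hroot : ∀ r ∈ G.roots, σ * (1 / (t - r)).im < 0 := by
    intro r hr
    have hr' : σ * r.im < 0 := by
      by_contra! hcon
      exact hG r hcon (Polynomial.isRoot_of_mem_roots hr)
    have hne : t - r ≠ 0 := by
      intro h0
      rw [sub_eq_zero.mp h0] at ht
      linarith
    rw [one_div, Complex.inv_im]
    have : σ * (-(t - r).im / Complex.normSq (t - r))
        = -((σ * t.im - σ * r.im) / Complex.normSq (t - r)) := by
      rw [Complex.sub_im]; ring
    rw [this, neg_lt_zero]
    exact div_pos (by linarith) (Complex.normSq_pos.mpr hne)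
  have key : ∀ s : Multiset ℂ, (∀ r ∈ s, σ * (1 / (t - r)).im < 0) → s ≠ 0 →
      σ * ((s.map fun r => 1 / (t - r)).sum).im < 0 := by
    intro s
    induction s using Multiset.induction_on with
    | empty => intro _ h0; exact absurd rfl h0
    | cons a s ih =>
      intro hs _
      rw [Multiset.map_cons, Multiset.sum_cons, Complex.add_im, mul_add]
      have h1 := hs a (Multiset.mem_cons_self a s)
      rcases eq_or_ne s 0 with rfl | h0
      · simpa using h1
      · have := ih (fun r hr => hs r (Multiset.mem_cons_of_mem hr)) h0
        linarith
  rcases eq_or_ne G.roots 0 with h0 | h0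
  · rw [h0] at hlog
    simp only [Multiset.map_zero, Multiset.sum_zero] at hlog
    rw [hlog] at huq
    simp at huq
  · have := key _ hroot h0
    rw [← hlog] at this
    linarith

/-- If `α + β s + δ s ^ 2` has no root in a closed half-plane bounded by the real axis, then
`α ≠ c δ` for all `c ≥ 0`. -/
theorem ne_ofReal_mul_of_quadratic_ne_zero {σ : ℝ} {α β δ : ℂ}
    (h : ∀ s : ℂ, 0 ≤ σ * s.im → α + β * s + δ * s ^ 2 ≠ 0) {c : ℝ} (hc : 0 ≤ c) :
    α ≠ c * δ := by
  intro hα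
  have hα0 : α ≠ 0 := by simpa using h 0 (by simp)
  have hδ : δ ≠ 0 := by rintro rfl; simp [hα] at hα0
  obtain ⟨s, hs⟩ := IsAlgClosed.exists_pow_nat_eq (k := ℂ) (discrim δ β α) (n := 2) (by norm_num)
  set s₁ : ℂ := (-β + s) / (2 * δ)
  have hs₁ : α + β * s₁ + δ * s₁ ^ 2 = 0 := by
    have := (quadratic_eq_zero_iff hδ (s := s) (by rw [← hs]; ring) s₁).mpr (Or.inl rfl)
    linear_combination this
  have him : σ * s₁.im < 0 := by
    by_contra! hcon
    exact h s₁ hcon hs₁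
  have hs0 : s₁ ≠ 0 := by rintro h0; simp [h0] at him
  refine h (c * s₁⁻¹) ?_ ?_
  · rw [Complex.im_ofReal_mul, Complex.inv_im]
    have : σ * (c * (-s₁.im / Complex.normSq s₁)) = c * (-(σ * s₁.im)) / Complex.normSq s₁ := by ring
    rw [this]
    exact div_nonneg (mul_nonneg hc (by linarith)) (Complex.normSq_nonneg _)
  · rw [hα] at hs₁ ⊢
    have : c * δ + β * (c * s₁⁻¹) + δ * (c * s₁⁻¹) ^ 2
        = c * s₁⁻¹ ^ 2 * (c * δ + β * s₁ + δ * s₁ ^ 2) := by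
      clear_value s₁
      field_simp
      ring
    rw [this, hs₁, mul_zero]

/-- Averaging over a real random variable `ξ` with finite support: if the bi-affine polynomial
`α + β s + γ t + δ s t` has no zero with both `s` and `t` in a closed half-plane, then the
expectation of its value at `(-ξ, ξ)` is nonzero. -/
theorem sum_biaffine_ne_zero {σ : ℝ} {α β γ δ : ℂ}
    (h : ∀ s t : ℂ, 0 ≤ σ * s.im → 0 ≤ σ * t.im → α + β * s + γ * t + δ * (s * t) ≠ 0)
    (S : Finset ℝ) (w : ℝ → ℝ) (hw : ∀ x, 0 ≤ w x) (hw1 : ∑ x ∈ S, w x = 1) :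
    ∑ x ∈ S, (w x : ℂ) * (α + β * (-(x : ℂ)) + γ * x + δ * (-(x : ℂ) * x)) ≠ 0 := by
  set a : ℝ := ∑ x ∈ S, w x * x with ha
  set b : ℝ := ∑ x ∈ S, w x * x ^ 2 with hb
  have hvar : 0 ≤ b - a ^ 2 := by
    have h0 : 0 ≤ ∑ x ∈ S, w x * (x - a) ^ 2 :=
      Finset.sum_nonneg fun x _ => mul_nonneg (hw x) (sq_nonneg _)
    have h1 : ∀ y, ∑ x ∈ S, w x * (x - y) ^ 2 = b - 2 * y * a + y ^ 2 * ∑ x ∈ S, w x := by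
      intro y
      rw [hb, ha, Finset.mul_sum, Finset.mul_sum, ← Finset.sum_sub_distrib, ← Finset.sum_add_distrib]
      exact Finset.sum_congr rfl fun x _ => by ring
    rw [h1, hw1] at h0
    linarith
  have hsum : ∑ x ∈ S, (w x : ℂ) * (α + β * (-(x : ℂ)) + γ * x + δ * (-(x : ℂ) * x))
      = α - a * β + a * γ - b * δ := by
    have e1 : ((∑ x ∈ S, w x : ℝ) : ℂ) = 1 := by rw [hw1]; simp
    have e : ∑ x ∈ S, (w x : ℂ) * (α + β * (-(x : ℂ)) + γ * x + δ * (-(x : ℂ) * x))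
        = ((∑ x ∈ S, w x : ℝ) : ℂ) * α - a * β + a * γ - b * δ := by
      rw [ha, hb]
      push_cast
      simp only [Finset.sum_mul]
      rw [← Finset.sum_sub_distrib, ← Finset.sum_add_distrib, ← Finset.sum_sub_distrib]
      exact Finset.sum_congr rfl fun x _ => by ring
    rw [e, e1, one_mul]
  rw [hsum]
  have hquad := ne_ofReal_mul_of_quadratic_ne_zero (σ := σ)
    (α := α - a * β + a * γ - a ^ 2 * δ) (β := (β + a * δ) + (γ - a * δ)) (δ := δ)
    (fun s hs => ?_) hvar
  · intro h0
    apply hquad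
    push_cast
    linear_combination h0
  · have := h (s - a) (s + a) (by simpa using hs) (by simpa using hs)
    intro h0
    apply this
    linear_combination h0

/-- A function of a finite tuple that is affine in each of its arguments. -/
def SeparatelyAffine {n : ℕ} (φ : (Fin n → ℂ) → ℂ) : Prop :=
  ∀ u i s, φ (Function.update u i s) =
    (1 - s) * φ (Function.update u i 0) + s * φ (Function.update u i 1)

/-- Averaging `Φ (-ε) ε` over independent real random variables `ε i` with finite support does not
vanish if `Φ` is separately affine and has no zeros over a closed half-plane. -/
theorem sum_separatelyAffine_ne_zero {σ : ℝ} {n : ℕ} {Φ : (Fin n → ℂ) → (Fin n → ℂ) → ℂ}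
    (hl : ∀ v, SeparatelyAffine fun u => Φ u v) (hr : ∀ u, SeparatelyAffine (Φ u))
    (hΦ : ∀ u v, (∀ i, 0 ≤ σ * (u i).im) → (∀ i, 0 ≤ σ * (v i).im) → Φ u v ≠ 0)
    (S : Fin n → Finset ℝ) (w : Fin n → ℝ → ℝ) (hw : ∀ i x, 0 ≤ w i x)
    (hw1 : ∀ i, ∑ x ∈ S i, w i x = 1) :
    ∑ ε ∈ Fintype.piFinset S, ((∏ i, w i (ε i) : ℝ) : ℂ) *
      Φ (fun i => -(ε i : ℂ)) (fun i => (ε i : ℂ)) ≠ 0 := by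
  induction n with
  | zero =>
    have : Fintype.piFinset S = {default} := by
      ext ε
      exact iff_of_true (Fintype.mem_piFinset.mpr fun i => i.elim0)
        (Finset.mem_singleton.mpr (Subsingleton.elim _ _))
    rw [this, Finset.sum_singleton]
    simpa using hΦ _ _ (fun i => i.elim0) (fun i => i.elim0)
  | succ n ih =>
    have hcons : ∀ (φ : (Fin (n + 1) → ℂ) → ℂ) (z : ℂ), SeparatelyAffine φ →
        SeparatelyAffine fun u => φ (Fin.cons z u) := by
      intro φ z hφ u i s
      simp only [Fin.cons_update]
      exact hφ _ _ _
    have hsumAff : ∀ (φ : ℝ → (Fin n → ℂ) → ℂ), (∀ x, SeparatelyAffine (φ x)) →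
        SeparatelyAffine fun u => ∑ x ∈ S 0, (w 0 x : ℂ) * φ x u := by
      intro φ hφ u i s
      simp only [Finset.mul_sum]
      rw [← Finset.sum_add_distrib]
      refine Finset.sum_congr rfl fun x _ => ?_
      rw [hφ x u i s]; ring
    have hzero : ∀ (φ : (Fin (n + 1) → ℂ) → ℂ), SeparatelyAffine φ → ∀ z u,
        φ (Fin.cons z u) = (1 - z) * φ (Fin.cons 0 u) + z * φ (Fin.cons 1 u) := by
      intro φ hφ z u
      simpa using hφ (Fin.cons 0 u) 0 z
    have := ih (Φ := fun u v => ∑ x ∈ S 0, (w 0 x : ℂ) *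
        Φ (Fin.cons (-(x : ℂ)) u) (Fin.cons (x : ℂ) v))
      (fun v => hsumAff (fun x u => Φ (Fin.cons (-(x : ℂ)) u) (Fin.cons (x : ℂ) v))
        fun x => hcons _ _ (hl _))
      (fun u => hsumAff (fun x v => Φ (Fin.cons (-(x : ℂ)) u) (Fin.cons (x : ℂ) v))
        fun x => hcons _ _ (hr _)) ?_ (Fin.tail S) (Fin.tail w) (fun i => hw i.succ)
      (fun i => hw1 i.succ)
    · convert this using 1
      simp only [Finset.mul_sum]
      rw [← Finset.sum_product']
      refine Finset.sum_nbij' (fun ε => (Fin.tail ε, ε 0)) (fun q => Fin.cons q.2 q.1)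
        ?_ ?_ ?_ ?_ ?_
      · intro ε hε
        rw [Fintype.mem_piFinset] at hε
        simp only [Finset.mem_product, Fintype.mem_piFinset]
        exact ⟨fun i => hε i.succ, hε 0⟩
      · rintro ⟨ε, x⟩ hq
        simp only [Finset.mem_product, Fintype.mem_piFinset] at hq
        rw [Fintype.mem_piFinset]
        intro i
        refine Fin.cases ?_ (fun j => ?_) i
        · exact hq.2
        · exact hq.1 j
      · intro ε _; simp
      · intro q _; simp
      · intro ε _
        have e1 : (fun i => -(ε i : ℂ)) =
            Fin.cons (-(ε 0 : ℂ)) (fun i => -(Fin.tail ε i : ℂ)) := by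
          ext i; refine Fin.cases ?_ (fun j => ?_) i <;> simp [Fin.tail]
        have e2 : (fun i => (ε i : ℂ)) =
            Fin.cons (ε 0 : ℂ) (fun i => (Fin.tail ε i : ℂ)) := by
          ext i; refine Fin.cases ?_ (fun j => ?_) i <;> simp [Fin.tail]
        rw [e1, e2, Fin.prod_univ_succ]
        simp only [Fin.tail]
        push_cast
        ring
    · intro u v hu hv
      have hexp : ∀ s t : ℂ, Φ (Fin.cons s u) (Fin.cons t v) =
          Φ (Fin.cons 0 u) (Fin.cons 0 v) +
          (Φ (Fin.cons 1 u) (Fin.cons 0 v) - Φ (Fin.cons 0 u) (Fin.cons 0 v)) * s +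
          (Φ (Fin.cons 0 u) (Fin.cons 1 v) - Φ (Fin.cons 0 u) (Fin.cons 0 v)) * t +
          (Φ (Fin.cons 1 u) (Fin.cons 1 v) - Φ (Fin.cons 1 u) (Fin.cons 0 v)
            - Φ (Fin.cons 0 u) (Fin.cons 1 v) + Φ (Fin.cons 0 u) (Fin.cons 0 v)) * (s * t) := by
        intro s t
        rw [hzero _ (hl (Fin.cons t v)) s u, hzero _ (hr (Fin.cons 0 u)) t v,
          hzero _ (hr (Fin.cons 1 u)) t v]
        ring
      have hne := sum_biaffine_ne_zero (σ := σ) (fun s t hs ht => by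
        rw [← hexp s t]
        refine hΦ _ _ (fun i => ?_) (fun i => ?_)
        · refine Fin.cases ?_ (fun j => ?_) i
          · simpa using hs
          · simpa using hu j
        · refine Fin.cases ?_ (fun j => ?_) i
          · simpa using ht
          · simpa using hv j) (S 0) (w 0) (hw 0) (hw1 0)
      simpa only [← hexp] using hne

namespace MvPolynomial

/-- Evaluating a product of differential operators `1 + u i ∂_i` applied to `p` at the origin. -/
noncomputable def affineTransform {m : ℕ} (p : MvPolynomial (Fin m) ℂ) (u : Fin m → ℂ) : ℂ :=
  eval (fun _ => (0 : ℂ))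
    ((List.ofFn fun i : Fin m =>
      (1 + u i • (pderiv i).toLinearMap : Module.End ℂ (MvPolynomial (Fin m) ℂ))).prod p)

theorem separatelyAffine_affineTransform {m : ℕ} (p : MvPolynomial (Fin m) ℂ) :
    SeparatelyAffine (affineTransform p) := by
  intro u i s
  set M := MultilinearMap.mkPiAlgebraFin ℂ m (Module.End ℂ (MvPolynomial (Fin m) ℂ))
  set D : (Fin m → ℂ) → Fin m → Module.End ℂ (MvPolynomial (Fin m) ℂ) :=
    fun u i => 1 + u i • (pderiv i).toLinearMap with hD
  have hM : ∀ u, affineTransform p u = eval (fun _ => (0 : ℂ)) (M (D u) p) := fun u => rfl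
  have hupd : ∀ z, D (Function.update u i z)
      = Function.update (D u) i (1 + z • (pderiv i).toLinearMap) := by
    intro z
    ext1 j
    rcases eq_or_ne j i with rfl | hj
    · simp [hD]
    · simp [hD, Function.update_of_ne hj]
  have hadd : ∀ z, affineTransform p (Function.update u i z) =
      eval (fun _ => (0 : ℂ)) (M (Function.update (D u) i 1) p) +
        z * eval (fun _ => (0 : ℂ)) (M (Function.update (D u) i (pderiv i).toLinearMap) p) := by
    intro z
    rw [hM, hupd, MultilinearMap.map_update_add, MultilinearMap.map_update_smul,
      LinearMap.add_apply, LinearMap.smul_apply, map_add, smul_eval]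
  rw [hadd s, hadd 0, hadd 1]
  ring

/-- Operators intertwined by a map have intertwined products. -/
theorem _root_.List.prod_ofFn_apply_comm {R R' M M' : Type*} [Semiring R] [Semiring R']
    [AddCommMonoid M] [Module R M] [AddCommMonoid M'] [Module R' M'] (φ : M → M') {n : ℕ}
    (a : Fin n → Module.End R M) (b : Fin n → Module.End R' M')
    (h : ∀ i q, φ (a i q) = b i (φ q)) (q : M) :
    φ ((List.ofFn a).prod q) = (List.ofFn b).prod (φ q) := by
  induction n with
  | zero => simp
  | succ n ih =>
    simp only [List.ofFn_succ, List.prod_cons, Module.End.mul_apply]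
    rw [h, ih _ _ fun i => h i.succ]

/-- Properties preserved by each of finitely many operators are preserved by their product. -/
theorem _root_.List.prod_ofFn_apply_induction {R M : Type*} [Semiring R]
    [AddCommMonoid M] [Module R M] {P : M → Prop} {n : ℕ}
    (a : Fin n → Module.End R M) (h : ∀ i q, P q → P (a i q)) {q : M} (hq : P q) :
    P ((List.ofFn a).prod q) := by
  induction n with
  | zero => simpa
  | succ n ih =>
    simp only [List.ofFn_succ, List.prod_cons, Module.End.mul_apply]
    exact h _ _ (ih _ fun i => h i.succ)

theorem eval_add_mul_pderiv_ne_zero {ι : Type*} {σ : ℝ} {q : MvPolynomial ι ℂ}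
    (hq : ∀ z : ι → ℂ, (∀ j, 0 ≤ σ * (z j).im) → eval z q ≠ 0) {u : ℂ} (hu : 0 ≤ σ * u.im)
    (i : ι) {z : ι → ℂ} (hz : ∀ j, 0 ≤ σ * (z j).im) :
    eval z q + u * eval z (pderiv i q) ≠ 0 := by
  classical
  set φ : MvPolynomial ι ℂ →ₐ[ℂ] Polynomial ℂ :=
    aeval (Function.update (fun j => Polynomial.C (z j)) i Polynomial.X) with hφ
  have heval : ∀ (t : ℂ) (p : MvPolynomial ι ℂ),
      (φ p).eval t = eval (Function.update z i t) p := by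
    intro t p
    induction p using MvPolynomial.induction_on with
    | C a => simp [hφ]
    | add p q hp hq => simp [hp, hq]
    | mul_X p j hp =>
      rw [map_mul, Polynomial.eval_mul, hp, map_mul]
      rcases eq_or_ne j i with rfl | hj
      · simp [hφ]
      · simp [hφ, Function.update_of_ne hj]
  have hder : ∀ p : MvPolynomial ι ℂ, (φ p).derivative = φ (pderiv i p) := by
    intro p
    induction p using MvPolynomial.induction_on with
    | C a => simp [hφ]
    | add p q hp hq => simp [hp, hq]
    | mul_X p j hp =>
      rw [map_mul, Polynomial.derivative_mul, hp, pderiv_mul, map_add, map_mul, map_mul]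
      rcases eq_or_ne j i with rfl | hj
      · simp [hφ]
      · simp [hφ, Function.update_of_ne hj, pderiv_X_of_ne hj]
  have := Polynomial.eval_add_mul_derivative_ne_zero (σ := σ) (G := φ q) (t := z i) (u := u)
    (fun t ht => by
      rw [heval]
      refine hq _ fun j => ?_
      rcases eq_or_ne j i with rfl | hj
      · simpa using ht
      · simpa [Function.update_of_ne hj] using hz j) (hz i) hu
  rwa [hder, heval, heval, Function.update_eq_self] at this

theorem affineTransform_ne_zero {m : ℕ} {σ : ℝ} {p : MvPolynomial (Fin m) ℂ}
    (hp : ∀ z : Fin m → ℂ, (∀ j, 0 ≤ σ * (z j).im) → eval z p ≠ 0) {u : Fin m → ℂ}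
    (hu : ∀ j, 0 ≤ σ * (u j).im) : affineTransform p u ≠ 0 := by
  refine List.prod_ofFn_apply_induction
    (P := fun q => ∀ z : Fin m → ℂ, (∀ j, 0 ≤ σ * (z j).im) → eval z q ≠ 0)
    _ (fun i q hq z hz => ?_) hp _ (by simp)
  simpa [smul_eval] using eval_add_mul_pderiv_ne_zero hq (hu i) i hz

theorem pderiv_aeval_C_mul_X {R ι : Type*} [CommRing R] (c : ι → R) (i : ι)
    (q : MvPolynomial ι R) :
    pderiv i (aeval (fun j => C (c j) * X j : ι → MvPolynomial ι R) q)
      = c i • aeval (fun j => C (c j) * X j : ι → MvPolynomial ι R) (pderiv i q) := by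
  classical
  induction q using MvPolynomial.induction_on with
  | C a => simp [algebraMap_eq]
  | add p q hp hq => simp only [map_add, hp, hq, smul_add]
  | mul_X p j hp =>
    rw [map_mul, pderiv_mul, hp, pderiv_mul, map_add, map_mul, map_mul, smul_add, smul_mul_assoc]
    congr 1
    rcases eq_or_ne j i with rfl | hj
    · simp [smul_eq_C_mul]; ring
    · simp [pderiv_X_of_ne hj]

end MvPolynomial

/-- The polynomial `det (x I + ∑ z_i A_i)` in the variables `z_i`. -/
noncomputable def detPencil {m d : ℕ} (A : Fin m → Matrix (Fin d) (Fin d) ℂ) (x : ℂ) :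
    MvPolynomial (Fin m) ℂ :=
  Matrix.det (Matrix.of fun a b => MvPolynomial.C x * (if a = b then 1 else 0) +
    ∑ i, MvPolynomial.X i * MvPolynomial.C (A i a b))

theorem eval_detPencil {m d : ℕ} (A : Fin m → Matrix (Fin d) (Fin d) ℂ) (x : ℂ) (z : Fin m → ℂ) :
    MvPolynomial.eval z (detPencil A x) =
      (x • (1 : Matrix (Fin d) (Fin d) ℂ) + ∑ i, z i • A i).det := by
  rw [detPencil, RingHom.map_det]
  congr 1
  ext a b
  simp [Matrix.one_apply, Matrix.sum_apply, apply_ite]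

theorem Matrix.PosSemidef.det_pencil_ne_zero {m d : ℕ} {A : Fin m → Matrix (Fin d) (Fin d) ℂ}
    (hA : ∀ i, (A i).PosSemidef) {σ : ℝ} {x : ℂ} (hx : 0 < σ * x.im) {z : Fin m → ℂ}
    (hz : ∀ i, 0 ≤ σ * (z i).im) :
    (x • (1 : Matrix (Fin d) (Fin d) ℂ) + ∑ i, z i • A i).det ≠ 0 := by
  intro hdet
  obtain ⟨v, hv, hmul⟩ := Matrix.exists_mulVec_eq_zero_iff.mpr hdet
  have h := congrArg (fun y => dotProduct (star v) y) hmul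
  simp only [Matrix.add_mulVec, Matrix.smul_mulVec, Matrix.one_mulVec, Matrix.sum_mulVec,
    dotProduct_add, dotProduct_smul, dotProduct_sum, dotProduct_zero, smul_eq_mul] at h
  have hv0 : 0 < dotProduct (star v) v := dotProduct_star_self_pos_iff.mpr hv
  have him : ∀ (y : ℂ) {c : ℂ}, 0 ≤ c → σ * (y * c).im = σ * y.im * c.re := by
    intro y c hc
    rw [Complex.mul_im, ← (Complex.nonneg_iff.mp hc).2]
    ring
  have h' := congrArg (fun y : ℂ => σ * y.im) h
  simp only [Complex.add_im, Complex.im_sum, mul_add, Finset.mul_sum, Complex.zero_im,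
    mul_zero] at h'
  rw [him _ hv0.le, Finset.sum_congr rfl fun i _ => him _ ((hA i).dotProduct_mulVec_nonneg v)]
    at h'
  have h1 : 0 < σ * x.im * (dotProduct (star v) v).re := mul_pos hx (Complex.pos_iff.mp hv0).1
  have h2 : 0 ≤ ∑ i, σ * (z i).im * (dotProduct (star v) ((A i).mulVec v)).re := Finset.sum_nonneg fun i _ =>
    mul_nonneg (hz i) (Complex.nonneg_iff.mp ((hA i).dotProduct_mulVec_nonneg v)).1
  linarith

theorem eval_mixedCharPoly_smul {m d : ℕ} (A : Fin m → Matrix (Fin d) (Fin d) ℂ) (c : Fin m → ℂ)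
    (x : ℂ) : (mixedCharPoly fun i => c i • A i).eval x =
      (detPencil A x).affineTransform fun i => -c i := by
  set ψ : MvPolynomial (Fin m) (Polynomial ℂ) →+* MvPolynomial (Fin m) ℂ :=
    MvPolynomial.map (Polynomial.evalRingHom x) with hψ
  set τ : MvPolynomial (Fin m) ℂ →ₐ[ℂ] MvPolynomial (Fin m) ℂ :=
    MvPolynomial.aeval fun j => MvPolynomial.C (c j) * MvPolynomial.X j with hτ
  have hψ0 : ∀ q, (MvPolynomial.eval (fun _ => (0 : Polynomial ℂ)) q).eval x =
      MvPolynomial.eval (fun _ => (0 : ℂ)) (ψ q) := by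
    intro q
    rw [hψ, MvPolynomial.eval_map, ← Polynomial.coe_evalRingHom, MvPolynomial.eval,
      MvPolynomial.coe_eval₂Hom, MvPolynomial.eval₂_comp_left]
    congr 1
    ext; simp
  have hτ0 : ∀ q, MvPolynomial.eval (fun _ => (0 : ℂ)) (τ q) =
      MvPolynomial.eval (fun _ => (0 : ℂ)) q := by
    intro q
    induction q using MvPolynomial.induction_on with
    | C a => simp [hτ, MvPolynomial.algebraMap_eq]
    | add p q hp hq => simp only [map_add, hp, hq]
    | mul_X p j hp => simp [hτ]
  have hdet : ψ (Matrix.det (Matrix.of fun a b =>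
        MvPolynomial.C Polynomial.X * (if a = b then 1 else 0) +
          ∑ i, MvPolynomial.X i * MvPolynomial.C (Polynomial.C ((c i • A i) a b)))) =
      τ (detPencil A x) := by
    rw [detPencil, RingHom.map_det, AlgHom.map_det]
    congr 1
    ext1 a b
    simp only [hψ, hτ, RingHom.mapMatrix_apply, AlgHom.mapMatrix_apply, Matrix.map_apply,
      Matrix.of_apply, map_add, map_mul, map_sum, MvPolynomial.map_C, MvPolynomial.map_X,
      MvPolynomial.aeval_C, MvPolynomial.aeval_X, apply_ite, map_one, map_zero,
      MvPolynomial.algebraMap_eq, Matrix.smul_apply, smul_eq_mul, Polynomial.coe_evalRingHom,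
      Polynomial.eval_X, Polynomial.eval_C]
    congr 1
    exact Finset.sum_congr rfl fun i _ => by ring
  rw [mixedCharPoly, hψ0, List.prod_ofFn_apply_comm ψ _
      (fun i => (1 - (MvPolynomial.pderiv i).toLinearMap :
        Module.End ℂ (MvPolynomial (Fin m) ℂ))) ?_, hdet,
    ← List.prod_ofFn_apply_comm τ
      (fun i => (1 + (-c i) • (MvPolynomial.pderiv i).toLinearMap :
        Module.End ℂ (MvPolynomial (Fin m) ℂ))) _ ?_, hτ0]
  · rfl
  · intro i q
    have := MvPolynomial.pderiv_aeval_C_mul_X c i q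
    simp only [LinearMap.add_apply, LinearMap.sub_apply, LinearMap.smul_apply, Module.End.one_apply,
      Derivation.coeFn_coe, map_add, map_smul]
    rw [this, neg_smul, sub_eq_add_neg]
  · intro i q
    simp [hψ, MvPolynomial.pderiv_map]

namespace MvPolynomial

/-- The total degree of a polynomial in the variables of `ι` over `ℂ[x]`, the variable `x`
included, is less than `k`. -/
def JointDegreeLT {ι : Type*} (k : ℕ) (F : MvPolynomial ι (Polynomial ℂ)) : Prop :=
  ∀ (α : ι →₀ ℕ) (n : ℕ), k ≤ n + α.degree → (coeff α F).coeff n = 0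

namespace JointDegreeLT

variable {ι : Type*} {k l : ℕ} {F G : MvPolynomial ι (Polynomial ℂ)}

theorem mono (hF : JointDegreeLT k F) (h : k ≤ l) : JointDegreeLT l F :=
  fun α n hn => hF α n (h.trans hn)

theorem add (hF : JointDegreeLT k F) (hG : JointDegreeLT k G) : JointDegreeLT k (F + G) :=
  fun α n hn => by rw [coeff_add, Polynomial.coeff_add, hF α n hn, hG α n hn, add_zero]

theorem neg (hF : JointDegreeLT k F) : JointDegreeLT k (-F) :=
  fun α n hn => by rw [coeff_neg, Polynomial.coeff_neg, hF α n hn, neg_zero]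

theorem sub (hF : JointDegreeLT k F) (hG : JointDegreeLT k G) : JointDegreeLT k (F - G) := by
  rw [sub_eq_add_neg]; exact hF.add hG.neg

theorem zero : JointDegreeLT k (0 : MvPolynomial ι (Polynomial ℂ)) := fun α n _ => by simp

theorem sum {κ : Type*} {s : Finset κ} {f : κ → MvPolynomial ι (Polynomial ℂ)}
    (h : ∀ i ∈ s, JointDegreeLT k (f i)) : JointDegreeLT k (∑ i ∈ s, f i) :=
  Finset.sum_induction f _ (fun _ _ => add) zero h

theorem mul (hF : JointDegreeLT (k + 1) F) (hG : JointDegreeLT (l + 1) G) :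
    JointDegreeLT (k + l + 1) (F * G) := by
  classical
  intro α n hn
  rw [coeff_mul, Polynomial.finsetSum_coeff]
  refine Finset.sum_eq_zero fun p hp => ?_
  rw [Polynomial.coeff_mul]
  refine Finset.sum_eq_zero fun q hq => ?_
  rw [Finset.HasAntidiagonal.mem_antidiagonal] at hp hq
  have hdeg : p.1.degree + p.2.degree = α.degree := by rw [← hp, map_add]
  rcases le_or_gt (k + 1) (q.1 + p.1.degree) with h | h
  · rw [hF _ _ h, zero_mul]
  · rw [hG p.2 q.2 (by omega), mul_zero]

theorem C_C (c : ℂ) :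
    JointDegreeLT 1 (C (Polynomial.C c) : MvPolynomial ι (Polynomial ℂ)) := by
  classical
  intro α n hn
  rw [coeff_C]
  split_ifs with h
  · subst h
    rw [map_zero] at hn
    rw [Polynomial.coeff_C_of_ne_zero (by omega)]
  · simp

theorem C_X : JointDegreeLT 2 (C Polynomial.X : MvPolynomial ι (Polynomial ℂ)) := by
  classical
  intro α n hn
  rw [coeff_C]
  split_ifs with h
  · subst h
    rw [map_zero] at hn
    rw [Polynomial.coeff_X_of_ne_one (by omega)]
  · simp

theorem X (i : ι) : JointDegreeLT 2 (MvPolynomial.X i : MvPolynomial ι (Polynomial ℂ)) := by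
  classical
  intro α n hn
  rw [coeff_X]
  split_ifs with h
  · subst h
    rw [Finsupp.degree_single] at hn
    rw [Polynomial.coeff_one, if_neg (by omega)]
  · simp

theorem one : JointDegreeLT 1 (1 : MvPolynomial ι (Polynomial ℂ)) := by
  simpa using C_C (ι := ι) 1

theorem prod {κ : Type*} (s : Finset κ) {f : κ → MvPolynomial ι (Polynomial ℂ)}
    (h : ∀ i ∈ s, JointDegreeLT 2 (f i)) : JointDegreeLT (s.card + 1) (∏ i ∈ s, f i) := by
  classical
  induction s using Finset.induction_on with
  | empty => simpa using one
  | insert a s ha ih =>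
    rw [Finset.prod_insert ha, Finset.card_insert_of_notMem ha, add_comm s.card]
    exact (h a (Finset.mem_insert_self a s)).mul
      (ih fun i hi => h i (Finset.mem_insert_of_mem hi))

theorem det {d : ℕ} {M : Matrix (Fin d) (Fin d) (MvPolynomial ι (Polynomial ℂ))}
    (h : ∀ a b, JointDegreeLT 2 (M a b)) : JointDegreeLT (d + 1) M.det := by
  rw [Matrix.det_apply]
  refine sum fun π _ => ?_
  have := prod Finset.univ fun i (_ : i ∈ Finset.univ) => h (π i) i
  rw [Finset.card_univ, Fintype.card_fin] at this
  rcases Int.units_eq_one_or (Equiv.Perm.sign π) with hs | hs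
  · simpa [hs] using this
  · simpa [hs] using this.neg

theorem pderiv (hF : JointDegreeLT (k + 1) F) (i : ι) :
    JointDegreeLT k (MvPolynomial.pderiv i F) := by
  intro α n hn
  rw [coeff_pderiv]
  have h := hF (α + Finsupp.single i 1) n (by rw [map_add, Finsupp.degree_single]; omega)
  have e : ((α i : Polynomial ℂ) + 1) = Polynomial.C ((α i : ℂ) + 1) := by simp
  rw [e, Polynomial.coeff_mul_C, h, zero_mul]

end JointDegreeLT

end MvPolynomial

theorem mixedCharPoly_eq_X_pow_add {m d : ℕ} (A : Fin m → Matrix (Fin d) (Fin d) ℂ) :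
    ∃ r : Polynomial ℂ, r.degree < d ∧ mixedCharPoly A = Polynomial.X ^ d + r := by
  set M : Matrix (Fin d) (Fin d) (MvPolynomial (Fin m) (Polynomial ℂ)) :=
    Matrix.of fun a b => MvPolynomial.C Polynomial.X * (if a = b then 1 else 0) +
      ∑ i, MvPolynomial.X i * MvPolynomial.C (Polynomial.C (A i a b)) with hM
  have hdet : MvPolynomial.JointDegreeLT (d + 1) M.det := by
    refine MvPolynomial.JointDegreeLT.det fun a b => ?_
    rw [hM, Matrix.of_apply]
    refine .add ?_ (.sum fun i _ => .mul (.X i) (.C_C _))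
    split_ifs
    · simpa using MvPolynomial.JointDegreeLT.C_X
    · simpa using MvPolynomial.JointDegreeLT.zero
  set T := (List.ofFn fun i : Fin m =>
        ((1 : Module.End (Polynomial ℂ) (MvPolynomial (Fin m) (Polynomial ℂ))) -
          (MvPolynomial.pderiv i).toLinearMap :
          Module.End (Polynomial ℂ) (MvPolynomial (Fin m) (Polynomial ℂ)))).prod with hT
  have hdiff : MvPolynomial.JointDegreeLT d (T M.det - M.det) := by
    refine List.prod_ofFn_apply_induction
      (P := fun q => MvPolynomial.JointDegreeLT d (q - M.det)) _ (fun i q hq => ?_) ?_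
    · have hq' : MvPolynomial.JointDegreeLT (d + 1) q := by
        simpa using (hq.mono d.le_succ).add hdet
      have := hq.sub (hq'.pderiv i)
      simpa [sub_right_comm] using this
    · simpa using MvPolynomial.JointDegreeLT.zero
  have heval : MvPolynomial.eval (fun _ => (0 : Polynomial ℂ)) M.det = Polynomial.X ^ d := by
    rw [RingHom.map_det]
    have : (MvPolynomial.eval fun _ => (0 : Polynomial ℂ)).mapMatrix M =
        Matrix.diagonal fun _ : Fin d => (Polynomial.X : Polynomial ℂ) := by
      ext1 a b
      rcases eq_or_ne a b with rfl | hab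
      · simp [hM]
      · simp [hM, hab]
    rw [this, Matrix.det_diagonal]
    simp
  refine ⟨MvPolynomial.eval (fun _ => (0 : Polynomial ℂ)) (T M.det - M.det), ?_, ?_⟩
  · rw [Polynomial.degree_lt_iff_coeff_zero]
    intro n hn
    have := hdiff 0 n (by simpa using hn)
    rwa [← MvPolynomial.constantCoeff_eq, ← MvPolynomial.eval_zero'] at this
  · rw [← heval, ← map_add, add_sub_cancel]
    rfl

theorem mixedCharPoly_monic {m d : ℕ} (A : Fin m → Matrix (Fin d) (Fin d) ℂ) :
    (mixedCharPoly A).Monic := by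
  obtain ⟨r, hr, h⟩ := mixedCharPoly_eq_X_pow_add A
  rw [h]
  exact Polynomial.monic_X_pow_add hr

theorem natDegree_mixedCharPoly {m d : ℕ} (A : Fin m → Matrix (Fin d) (Fin d) ℂ) :
    (mixedCharPoly A).natDegree = d := by
  obtain ⟨r, hr, h⟩ := mixedCharPoly_eq_X_pow_add A
  rw [h]
  refine Polynomial.natDegree_eq_of_degree_eq_some ?_
  rw [Polynomial.degree_add_eq_left_of_degree_lt (by rwa [Polynomial.degree_X_pow]),
    Polynomial.degree_X_pow]

theorem realRooted_sum_mixedCharPoly_mul {m d : ℕ} {A : Fin m → Matrix (Fin d) (Fin d) ℂ}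
    (hA : ∀ i, (A i).PosSemidef) (S : Fin m → Finset ℝ) (w : Fin m → ℝ → ℝ)
    (hw : ∀ i x, 0 ≤ w i x) (hw1 : ∀ i, ∑ x ∈ S i, w i x = 1) :
    RealRooted (∑ ε ∈ Fintype.piFinset S, ((∏ i, w i (ε i) : ℝ) : ℂ) •
      ((mixedCharPoly fun i => (ε i : ℂ) • A i) *
        (mixedCharPoly fun i => (-(ε i) : ℂ) • A i))) := by
  intro x hroot
  by_contra hx
  set g := (detPencil A x).affineTransform with hg
  have hgne : ∀ u : Fin m → ℂ, (∀ i, 0 ≤ x.im * (u i).im) → g u ≠ 0 := fun u hu =>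
    MvPolynomial.affineTransform_ne_zero (fun z hz => by
      rw [eval_detPencil]
      exact Matrix.PosSemidef.det_pencil_ne_zero hA (mul_self_pos.mpr hx) hz) hu
  have hgaff : SeparatelyAffine g := MvPolynomial.separatelyAffine_affineTransform _
  refine sum_separatelyAffine_ne_zero (Φ := fun u v => g u * g v) (σ := x.im)
    (fun v u i s => ?_) (fun u v i s => ?_)
    (fun u v hu hv => mul_ne_zero (hgne u hu) (hgne v hv)) S w hw hw1 ?_
  · simp only
    rw [hgaff u i s]; ring
  · simp only
    rw [hgaff v i s]; ring
  · rw [Polynomial.IsRoot.def, Polynomial.eval_finsetSum] at hroot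
    rw [← hroot]
    refine Finset.sum_congr rfl fun ε _ => ?_
    rw [Polynomial.eval_smul, Polynomial.eval_mul, smul_eq_mul,
      eval_mixedCharPoly_smul A (fun i => (ε i : ℂ)) x,
      eval_mixedCharPoly_smul A (fun i => -(ε i : ℂ)) x]
    simp only [neg_neg, hg]

/-- the family
`f_{ε} = μ[ε_1 A_1,…,ε_m A_m]·μ[−ε_1 A_1,…,−ε_m A_m]`, indexed by tuples
`ε ∈ S_1 × … × S_m`, is an interlacing family (Theorem `qint`): each member is monic
real-rooted of degree `2d` and every mixture arising from independent random variables
`ξ_i` with values in `S_i` (encoded by probability mass functions `w i` on `S i`)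
has a real-rooted expected polynomial. -/
theorem statement8 {m d : ℕ} (A : Fin m → Matrix (Fin d) (Fin d) ℂ)
    (hA : ∀ i, (A i).PosSemidef) (S : Fin m → Finset ℝ) :
    (∀ ε ∈ Fintype.piFinset S,
      ((mixedCharPoly fun i => (ε i : ℂ) • A i) *
        (mixedCharPoly fun i => (-(ε i) : ℂ) • A i)).Monic ∧
      ((mixedCharPoly fun i => (ε i : ℂ) • A i) *
        (mixedCharPoly fun i => (-(ε i) : ℂ) • A i)).natDegree = 2 * d ∧
      RealRooted ((mixedCharPoly fun i => (ε i : ℂ) • A i) *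
        (mixedCharPoly fun i => (-(ε i) : ℂ) • A i))) ∧
    (∀ w : Fin m → ℝ → ℝ, (∀ i x, 0 ≤ w i x) → (∀ i, ∑ x ∈ S i, w i x = 1) →
      RealRooted (∑ ε ∈ Fintype.piFinset S, ((∏ i, w i (ε i) : ℝ) : ℂ) •
        ((mixedCharPoly fun i => (ε i : ℂ) • A i) *
          (mixedCharPoly fun i => (-(ε i) : ℂ) • A i)))) := by
  have hmain := fun w => realRooted_sum_mixedCharPoly_mul hA S w
  refine ⟨fun ε hε => ⟨(mixedCharPoly_monic _).mul (mixedCharPoly_monic _), ?_, ?_⟩, hmain⟩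
  · rw [(mixedCharPoly_monic _).natDegree_mul (mixedCharPoly_monic _), natDegree_mixedCharPoly,
      natDegree_mixedCharPoly, two_mul]
  · rw [Fintype.mem_piFinset] at hε
    have h := hmain (fun i x => if x = ε i then 1 else 0)
      (fun i x => by positivity) (fun i => by simp [hε i])
    rw [Finset.sum_eq_single_of_mem ε (Fintype.mem_piFinset.mpr hε)] at h
    · simpa using h
    · intro η _ hη
      obtain ⟨i, hi⟩ := Function.ne_iff.mp hη
      rw [Finset.prod_eq_zero (Finset.mem_univ i) (if_neg hi)]
      simp
end

section
/- Let Q ∈ ℝ[z_1,…,z_m] be a real stable polynomial, c ∈ ℝ, and i ∈ {1,…,m}. If z ∈ ℝ^m is above the roots of (1 + c·∂_{z_i})Q, then z + c·e_i is above the roots of Q, where e_i is the i-th standard basis vector of ℝ^m. -/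
/-- A real polynomial in several variables is real stable if it has no zero with all
coordinates in the open upper half plane. -/
def RealStable {σ : Type*} (p : MvPolynomial σ ℝ) : Prop :=
  ∀ z : σ → ℂ, (∀ i, 0 < (z i).im) → MvPolynomial.aeval z p ≠ 0

/-- A point `z ∈ ℝ^σ` is above the roots of `Q` if `Q(z + t) > 0` for all `t ≥ 0`. -/
def AboveRoots {σ : Type*} (Q : MvPolynomial σ ℝ) (z : σ → ℝ) : Prop :=
  ∀ t : σ → ℝ, (∀ i, 0 ≤ t i) → 0 < MvPolynomial.eval (z + t) Q

open Polynomial in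
theorem Multiset.eval_prod_X_sub_C_nonneg (s : Multiset ℝ) {x : ℝ} (h : ∀ r ∈ s, r ≤ x) :
    0 ≤ (s.map fun r => (X - C r : ℝ[X])).prod.eval x ∧
      0 ≤ (derivative (s.map fun r => (X - C r : ℝ[X])).prod).eval x := by
  induction s using Multiset.induction_on with
  | empty => simp
  | cons r s ih =>
    obtain ⟨h₁, h₂⟩ := ih fun a ha => h a (Multiset.mem_cons_of_mem ha)
    have hr : 0 ≤ x - r := sub_nonneg.2 (h r (Multiset.mem_cons_self r s))
    simp only [Multiset.map_cons, Multiset.prod_cons, derivative_mul, derivative_sub,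
      derivative_X, derivative_C, eval_add, eval_mul, eval_sub, eval_X, eval_C, sub_zero, one_mul]
    exact ⟨mul_nonneg hr h₁, add_nonneg h₁ (mul_nonneg hr h₂)⟩

theorem Multiset.exists_cons_max {s : Multiset ℝ} (hs : s ≠ 0) :
    ∃ a t, s = a ::ₘ t ∧ ∀ b ∈ t, b ≤ a := by
  classical
  obtain ⟨b, hb⟩ := Multiset.exists_mem_of_ne_zero hs
  obtain ⟨a, ha, hmax⟩ := s.toFinset.exists_max_image id ⟨b, Multiset.mem_toFinset.2 hb⟩
  obtain ⟨t, rfl⟩ := Multiset.exists_cons_of_mem (Multiset.mem_toFinset.1 ha)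
  exact ⟨a, t, rfl, fun b hb =>
    hmax b (Multiset.mem_toFinset.2 (Multiset.mem_cons_of_mem hb))⟩

open Polynomial in
theorem Multiset.lt_of_forall_pos_eval_add_derivative (s : Multiset ℝ) (c : ℝ)
    (h : ∀ x : ℝ, 0 ≤ x → 0 < (s.map fun r => (X - C r : ℝ[X])).prod.eval x +
      c * (derivative (s.map fun r => (X - C r : ℝ[X])).prod).eval x) :
    ∀ r ∈ s, r < c := by
  intro r₀ hr₀
  obtain ⟨l, t, rfl, hl⟩ := Multiset.exists_cons_max (s := s) (by rintro rfl; simp at hr₀)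
  have hle : r₀ ≤ l := by
    rcases Multiset.mem_cons.1 hr₀ with rfl | h'
    · exact le_rfl
    · exact hl _ h'
  refine hle.trans_lt ?_
  by_contra! hc
  simp only [Multiset.map_cons, Multiset.prod_cons, derivative_mul, derivative_sub,
    derivative_X, derivative_C, eval_add, eval_mul, eval_sub, eval_X, eval_C, sub_zero,
    one_mul] at h
  by_cases ht : ∀ b ∈ t, b ≤ l - c
  · have h₁ := h (l - c) (by linarith)
    have h₂ := (t.eval_prod_X_sub_C_nonneg ht).2
    nlinarith [mul_nonneg (sq_nonneg c) h₂]
  · push Not at ht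
    obtain ⟨b, hb, hbl⟩ := ht
    obtain ⟨k, u, rfl, hk⟩ := Multiset.exists_cons_max (s := t) (by rintro rfl; simp at hb)
    have hbk : b ≤ k := by
      rcases Multiset.mem_cons.1 hb with rfl | h'
      · exact le_rfl
      · exact hk _ h'
    have hkl := hl k (Multiset.mem_cons_self k u)
    have h₁ := h k (by linarith)
    have h₂ := (u.eval_prod_X_sub_C_nonneg hk).1
    simp only [Multiset.map_cons, Multiset.prod_cons, derivative_mul, derivative_sub,
      derivative_X, derivative_C, eval_add, eval_mul, eval_sub, eval_X, eval_C, sub_zero, one_mul,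
      sub_self, zero_mul, mul_zero, add_zero, zero_add] at h₁
    have hc0 : 0 ≤ c := by linarith
    have := mul_nonneg (mul_nonneg hc0 (sub_nonneg.2 hkl)) h₂
    nlinarith

open Polynomial in
theorem Polynomial.leadingCoeff_pos_of_forall_pos_eval_add_derivative {q : ℝ[X]} {c : ℝ}
    (h : ∀ x : ℝ, 0 ≤ x → 0 < q.eval x + c * (derivative q).eval x) :
    0 < q.leadingCoeff := by
  have hq : q ≠ 0 := by
    rintro rfl
    simpa using h 0 le_rfl
  by_contra! hlead
  rcases Nat.eq_zero_or_pos q.natDegree with hd | hd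
  · rw [eq_C_of_natDegree_eq_zero hd] at h hlead
    have := h 0 le_rfl
    simp at this hlead
    linarith
  · have hdeg : (C c * derivative q).degree < q.degree :=
      by
      rw [← smul_eq_C_mul]
      exact (degree_smul_le c _).trans_lt (degree_derivative_lt hq)
    have hp : (q + C c * derivative q).degree = q.degree := degree_add_eq_left_of_degree_lt hdeg
    have hl : (q + C c * derivative q).leadingCoeff = q.leadingCoeff :=
      leadingCoeff_add_of_degree_lt' hdeg
    have ht := tendsto_atBot_of_leadingCoeff_nonpos (q + C c * derivative q)
      (by rw [hp]; exact natDegree_pos_iff_degree_pos.1 hd) (by rw [hl]; exact hlead)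
    obtain ⟨x, hx₀, hx⟩ := ((Filter.eventually_ge_atTop 0).and
      (ht.eventually (Filter.eventually_le_atBot 0))).exists
    have := h x hx₀
    simp only [eval_add, eval_mul, eval_C] at hx
    linarith

open Polynomial in
theorem Polynomial.Splits.eval_pos_of_forall_pos_eval_add_derivative {q : ℝ[X]} (hs : q.Splits)
    {c : ℝ} (h : ∀ x : ℝ, 0 ≤ x → 0 < q.eval x + c * (derivative q).eval x) :
    0 < q.eval c := by
  have ha := leadingCoeff_pos_of_forall_pos_eval_add_derivative h
  have hprod := hs.eq_prod_roots
  have hr : ∀ r ∈ q.roots, r < c := by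
    refine q.roots.lt_of_forall_pos_eval_add_derivative c fun x hx => ?_
    have hx' := h x hx
    rw [hprod] at hx'
    simp only [derivative_C_mul, eval_mul, eval_C] at hx'
    refine pos_of_mul_pos_right (a := q.leadingCoeff) ?_ ha.le
    linarith
  rw [hprod, eval_mul, eval_C, eval_multiset_prod]
  refine mul_pos ha (Multiset.prod_pos ?_)
  simp only [Multiset.map_map, Multiset.mem_map, Function.comp_apply, eval_sub, eval_X, eval_C]
  rintro _ ⟨r, hr', rfl⟩
  exact sub_pos.2 (hr r hr')

open Polynomial in
/-- The modulus of a real-rooted complex polynomial increases along vertical rays that leave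
the real line. -/
theorem Polynomial.norm_eval_le_of_roots_real {p : ℂ[X]} (hp : ∀ w, p.eval w = 0 → w.im = 0)
    {w w' : ℂ} (hre : w.re = w'.re) (him : |w.im| ≤ |w'.im|) : ‖p.eval w‖ ≤ ‖p.eval w'‖ := by
  rcases eq_or_ne p 0 with rfl | hp0
  · simp
  have hroot : ∀ r ∈ p.roots, r.im = 0 := fun r hr => hp r ((mem_roots hp0).1 hr)
  have hprod := (IsAlgClosed.splits p).eq_prod_roots
  rw [hprod]
  simp only [eval_mul, eval_C, norm_mul]
  refine mul_le_mul_of_nonneg_left ?_ (norm_nonneg _)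
  clear hprod
  generalize p.roots = s at hroot
  induction s using Multiset.induction_on with
  | empty => simp
  | cons r s ih =>
    simp only [Multiset.map_cons, Multiset.prod_cons, eval_mul, norm_mul, eval_sub, eval_X, eval_C]
    refine mul_le_mul ?_ (ih fun a ha => hroot a (Multiset.mem_cons_of_mem ha))
      (norm_nonneg _) (norm_nonneg _)
    have hr := hroot r (Multiset.mem_cons_self r s)
    have hsq := sq_le_sq.2 him
    rw [Complex.norm_def, Complex.norm_def]
    apply Real.sqrt_le_sqrt
    simp only [Complex.normSq_apply, Complex.sub_re, Complex.sub_im, hr, hre]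
    nlinarith

namespace MvPolynomial

variable {σ : Type*}

/-- The restriction of a polynomial to the line `x + s v`. -/
noncomputable def lineRestrict (x v : σ → ℝ) : MvPolynomial σ ℝ →ₐ[ℝ] Polynomial ℝ :=
  aeval fun j => Polynomial.C (x j) + Polynomial.X * Polynomial.C (v j)

theorem aeval_lineRestrict {A : Type*} [CommRing A] [Algebra ℝ A] (Q : MvPolynomial σ ℝ)
    (x v : σ → ℝ) (s : A) :
    Polynomial.aeval s (lineRestrict x v Q) =
      aeval (fun j => algebraMap ℝ A (x j) + s * algebraMap ℝ A (v j)) Q := by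
  rw [lineRestrict, comp_aeval_apply]
  simp only [map_add, map_mul, Polynomial.aeval_X, Polynomial.aeval_C]

theorem eval_lineRestrict (Q : MvPolynomial σ ℝ) (x v : σ → ℝ) (s : ℝ) :
    (lineRestrict x v Q).eval s = eval (x + s • v) Q := by
  rw [← Polynomial.coe_aeval_eq_eval, aeval_lineRestrict, aeval_eq_eval]
  rfl

theorem derivative_lineRestrict_single [DecidableEq σ] (Q : MvPolynomial σ ℝ) (x : σ → ℝ)
    (i : σ) :
    Polynomial.derivative (lineRestrict x (Pi.single i 1) Q) =
      lineRestrict x (Pi.single i 1) (pderiv i Q) := by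
  induction Q using MvPolynomial.induction_on with
  | C a => simp [lineRestrict, ← algebraMap_eq, Polynomial.algebraMap_eq]
  | add p q hp hq => simp [hp, hq]
  | mul_X p j hp =>
    have hX : lineRestrict x (Pi.single i 1) (X j) = Polynomial.C (x j) +
        Polynomial.X * Polynomial.C ((Pi.single i 1 : σ → ℝ) j) := by simp [lineRestrict]
    rw [map_mul, Polynomial.derivative_mul, hp, pderiv_mul, map_add, map_mul, map_mul, hX]
    congr 2
    rcases eq_or_ne j i with rfl | hji
    · simp
    · simp [hji, pderiv_X_of_ne hji]

end MvPolynomial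

open MvPolynomial in
theorem RealStable.im_eq_zero_of_aeval_line_eq_zero {σ : Type*} {Q : MvPolynomial σ ℝ}
    (hQ : RealStable Q) (x : σ → ℝ) {v : σ → ℝ} (hv : ∀ j, 0 < v j) {s : ℂ}
    (hs : aeval (fun j => (x j : ℂ) + s * v j) Q = 0) : s.im = 0 := by
  have key : ∀ s : ℂ, aeval (fun j => (x j : ℂ) + s * v j) Q = 0 → s.im ≤ 0 := by
    intro s hs
    by_contra! him
    refine hQ _ (fun j => ?_) hs
    simpa using mul_pos him (hv j)
  refine le_antisymm (key s hs) ?_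
  have hconj : aeval (fun j => (x j : ℂ) + (starRingEnd ℂ) s * v j) Q = 0 := by
    have := congrArg Complex.conjAe hs
    rw [map_zero, ← AlgEquiv.coe_toAlgHom, comp_aeval_apply] at this
    simpa using this
  simpa using key _ hconj

open MvPolynomial in
theorem RealStable.norm_aeval_line_le {σ : Type*} [Finite σ] {Q : MvPolynomial σ ℝ}
    (hQ : RealStable Q) (x : σ → ℝ) {v : σ → ℝ} (hv : ∀ j, 0 ≤ v j) {s s' : ℂ}
    (hre : s.re = s'.re) (him : |s.im| ≤ |s'.im|) :
    ‖aeval (fun j => (x j : ℂ) + s * v j) Q‖ ≤ ‖aeval (fun j => (x j : ℂ) + s' * v j) Q‖ := by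
  have pos : ∀ ε : ℝ, 0 < ε →
      ‖aeval (fun j => (x j : ℂ) + s * (v j + ε : ℝ)) Q‖ ≤
        ‖aeval (fun j => (x j : ℂ) + s' * (v j + ε : ℝ)) Q‖ := by
    intro ε hε
    have h := Polynomial.norm_eval_le_of_roots_real
      (p := (lineRestrict x (fun j => v j + ε) Q).map (algebraMap ℝ ℂ)) (w := s) (w' := s')
      (fun w hw => hQ.im_eq_zero_of_aeval_line_eq_zero x (v := fun j => v j + ε)
        (fun j => by linarith [hv j])
        (by rwa [Polynomial.eval_map_algebraMap, aeval_lineRestrict] at hw)) hre him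
    rwa [Polynomial.eval_map_algebraMap, Polynomial.eval_map_algebraMap, aeval_lineRestrict,
      aeval_lineRestrict] at h
  have cont : ∀ s : ℂ, Continuous fun ε : ℝ =>
      ‖aeval (fun j => (x j : ℂ) + s * (v j + ε : ℝ)) Q‖ := by
    intro s
    simp only [aeval_def, ← eval_map]
    exact ((MvPolynomial.continuous_eval _).comp (by fun_prop)).norm
  have lim : ∀ s : ℂ, Filter.Tendsto (fun ε : ℝ =>
      ‖aeval (fun j => (x j : ℂ) + s * (v j + ε : ℝ)) Q‖) (nhdsWithin 0 (Set.Ioi 0))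
      (nhds ‖aeval (fun j => (x j : ℂ) + s * v j) Q‖) := fun s => by
    simpa using ((cont s).tendsto 0).mono_left nhdsWithin_le_nhds
  exact le_of_tendsto_of_tendsto (lim s) (lim s')
    (Filter.eventually_of_mem self_mem_nhdsWithin pos)

open MvPolynomial in
theorem RealStable.splits_lineRestrict {σ : Type*} [Finite σ] {Q : MvPolynomial σ ℝ}
    (hQ : RealStable Q) (x : σ → ℝ) {v : σ → ℝ} (hv : ∀ j, 0 ≤ v j) :
    (lineRestrict x v Q).Splits := by
  rcases eq_or_ne (lineRestrict x v Q) 0 with h0 | h0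
  · rw [h0]
    exact Polynomial.Splits.zero
  have hmap : (lineRestrict x v Q).map (algebraMap ℝ ℂ) ≠ 0 :=
    (Polynomial.map_ne_zero_iff (algebraMap ℝ ℂ).injective).2 h0
  refine (IsAlgClosed.splits ((lineRestrict x v Q).map (algebraMap ℝ ℂ))).of_splits_map
    (algebraMap ℝ ℂ) fun w hw => ?_
  have hw0 := (Polynomial.mem_roots hmap).1 hw
  rw [Polynomial.IsRoot, Polynomial.eval_map_algebraMap, aeval_lineRestrict] at hw0
  suffices him : w.im = 0 from ⟨w.re, Complex.ext (by simp) (by simp [him])⟩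
  by_contra him
  refine hmap (Polynomial.eq_zero_of_infinite_isRoot _ ?_)
  have hinj : Function.Injective fun y : ℝ => (⟨w.re, y⟩ : ℂ) := fun a b hab =>
    congrArg Complex.im hab
  refine ((Set.Icc_infinite (abs_pos.2 him)).image hinj.injOn).mono ?_
  rintro _ ⟨y, hy, rfl⟩
  have hle := hQ.norm_aeval_line_le x hv (s := ⟨w.re, y⟩) (s' := w) rfl
    (by simpa [abs_of_nonneg hy.1] using hy.2)
  have hw0' : aeval (fun j => (x j : ℂ) + w * v j) Q = 0 := hw0
  rw [hw0', norm_zero] at hle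
  rw [Set.mem_ofPred_eq, Polynomial.IsRoot, Polynomial.eval_map_algebraMap, aeval_lineRestrict]
  exact norm_le_zero_iff.1 hle

/-- if `z` is above the roots of `(1 + c∂_{z_i})Q` then `z + c e_i` is
above the roots of `Q` (Lemma `con`). -/
theorem statement10 {m : ℕ} (Q : MvPolynomial (Fin m) ℝ) (hQ : RealStable Q)
    (c : ℝ) (i : Fin m) (z : Fin m → ℝ)
    (h : AboveRoots (Q + c • MvPolynomial.pderiv i Q) z) :
    AboveRoots Q (z + c • (Pi.single i 1 : Fin m → ℝ)) := by
  intro t ht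
  have hv : ∀ j, 0 ≤ (Pi.single i 1 : Fin m → ℝ) j := by
    intro j
    rcases eq_or_ne j i with rfl | hj <;> simp [*]
  have hpos := (hQ.splits_lineRestrict (z + t) hv).eval_pos_of_forall_pos_eval_add_derivative
    (c := c) fun s hs => by
      rw [MvPolynomial.derivative_lineRestrict_single, MvPolynomial.eval_lineRestrict,
        MvPolynomial.eval_lineRestrict]
      have := h (t + s • (Pi.single i 1 : Fin m → ℝ))
        fun j => add_nonneg (ht j) (mul_nonneg hs (hv j))
      rwa [← add_assoc, map_add, MvPolynomial.smul_eval] at this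
  rwa [MvPolynomial.eval_lineRestrict, add_right_comm] at hpos
end

section
/- Let p ∈ ℝ[z_1,…,z_m] be real stable and let c ≥ 0. Suppose z ∈ ℝ^m lies above the roots of p and c²·( (2/δ_j)·Φ^j_p(z) + (Φ^j_p(z))² ) ≤ 1 for some j ∈ {1,…,m} and some δ_j > 0. Then z + δ_j·e_j lies above the roots of (1 − c²·∂²_{z_j})p, and Φ^i_{(1−c²∂²_{z_j})p}(z + δ_j e_j) ≤ Φ^i_p(z) for all i ∈ {1,…,m}. -/
/-- The barrier function `Φ^j_p(z) = ∂_{z_j} p(z) / p(z)`. -/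
noncomputable def barrier {σ : Type*} (p : MvPolynomial σ ℝ) (j : σ) (z : σ → ℝ) : ℝ :=
  MvPolynomial.eval z (MvPolynomial.pderiv j p) / MvPolynomial.eval z p

section

open Polynomial Set Filter Topology ComplexConjugate

/-- The rational function `N / D` maps the upper half plane to the closed lower half plane. -/
def MapsUpperToLower (N D : ℝ[X]) : Prop :=
  ∀ z : ℂ, 0 < z.im → (aeval z N * aeval (conj z) D).im ≤ 0

theorem MapsUpperToLower.wronskian_nonpos {N D : ℝ[X]} (h : MapsUpperToLower N D) (x : ℝ) :
    N.derivative.eval x * D.eval x - N.eval x * D.derivative.eval x ≤ 0 := by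
  have line (c : ℂ) : HasDerivAt (fun t : ℝ => (x : ℂ) + t * c) c 0 := by
    have h1 := ((Complex.ofRealCLM.hasDerivAt (x := (0 : ℝ))).mul_const c).const_add (x : ℂ)
    rw [Complex.ofRealCLM_apply, Complex.ofReal_one, one_mul] at h1
    exact h1
  have poly (P : ℝ[X]) (c : ℂ) : HasDerivAt (fun t : ℝ => aeval ((x : ℂ) + t * c) P)
      (c * (P.derivative.eval x : ℝ)) 0 := by
    have h1 : HasDerivAt (fun z : ℂ => aeval z P) (aeval ((x : ℂ) + (0 : ℝ) * c) P.derivative)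
      ((x : ℂ) + (0 : ℝ) * c) := P.hasDerivAt_aeval _
    have h2 := h1.scomp (0 : ℝ) (line c)
    have hx : aeval (x : ℂ) (derivative P) = ((eval x (derivative P) : ℝ) : ℂ) := by
      rw [← Complex.coe_algebraMap, aeval_algebraMap_apply, coe_aeval_eq_eval]
    rw [Complex.ofReal_zero, zero_mul, add_zero, hx, smul_eq_mul] at h2
    exact h2
  have hmul := (poly N Complex.I).mul (poly D (-Complex.I))
  have him := (Complex.imCLM.hasFDerivAt.comp_hasDerivAt (0 : ℝ) hmul).tendsto_slope_zero_right
  have hr (P : ℝ[X]) : aeval (x : ℂ) P = ((eval x P : ℝ) : ℂ) := by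
    rw [← Complex.coe_algebraMap, aeval_algebraMap_apply, coe_aeval_eq_eval]
  have key := le_of_tendsto him (b := 0) (by
    filter_upwards [self_mem_nhdsWithin] with t ht
    have ht : 0 < t := ht
    have h1 := h ((x : ℂ) + t * Complex.I) (by simpa using ht)
    have h0 : (conj ((x : ℂ) + t * Complex.I)) = (x : ℂ) + t * (-Complex.I) := by simp
    rw [h0] at h1
    simp only [Function.comp_def, Complex.imCLM_apply, zero_add, smul_eq_mul, Pi.mul_apply,
      Complex.ofReal_zero, zero_mul, add_zero, hr, ← Complex.ofReal_mul, Complex.ofReal_im,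
      sub_zero]
    exact mul_nonpos_of_nonneg_of_nonpos (by positivity) h1)
  simp [hr] at key
  linarith

theorem MapsUpperToLower.antitoneOn {N D : ℝ[X]} (h : MapsUpperToLower N D)
    (hD : ∀ x : ℝ, 0 ≤ x → D.eval x ≠ 0) :
    AntitoneOn (fun x : ℝ => N.eval x / D.eval x) (Ici 0) := by
  apply antitoneOn_of_deriv_nonpos (convex_Ici 0)
  · exact N.continuous.continuousOn.div D.continuous.continuousOn fun x hx => hD x hx
  · intro x hx
    rw [interior_Ici] at hx
    exact (N.differentiableAt.div D.differentiableAt (hD x hx.le)).differentiableWithinAt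
  · intro x hx
    rw [interior_Ici] at hx
    have := (N.hasDerivAt x).fun_div (D.hasDerivAt x) (hD x hx.le)
    rw [this.deriv]
    exact div_nonpos_of_nonpos_of_nonneg (h.wronskian_nonpos x) (sq_nonneg _)

theorem MapsUpperToLower.degree_le {N D : ℝ[X]} (h : MapsUpperToLower N D)
    (hD : ∀ x : ℝ, 0 ≤ x → D.eval x ≠ 0) (hf : ∀ x : ℝ, 0 ≤ x → 0 ≤ N.eval x / D.eval x) :
    N.degree ≤ D.degree := by
  by_contra! hlt
  have hD0 : D ≠ 0 := by rintro rfl; exact hD 0 le_rfl (by simp)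
  have ht := abs_div_tendsto_atTop_atTop_of_degree_gt N D hlt hD0
  obtain ⟨x, hx, hx0⟩ := ((ht.eventually_gt_atTop (N.eval 0 / D.eval 0)).and
    (eventually_ge_atTop (0 : ℝ))).exists
  rw [abs_of_nonneg (hf x hx0)] at hx
  exact absurd (h.antitoneOn hD (mem_Ici.2 le_rfl) (mem_Ici.2 hx0) hx0) (not_le.2 hx)

theorem MapsUpperToLower.local_im_nonpos {N E : ℝ[X]} {r : ℝ} {k : ℕ}
    (h : MapsUpperToLower N ((X - C r) ^ k * E)) {ω : ℂ} (hω : 0 < ω.im) :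
    N.eval r * E.eval r * (conj ω ^ k).im ≤ 0 := by
  have hr (P : ℝ[X]) : aeval (r : ℂ) P = ((eval r P : ℝ) : ℂ) := by
    rw [← Complex.coe_algebraMap, aeval_algebraMap_apply, coe_aeval_eq_eval]
  have hc : Continuous fun t : ℝ =>
      (aeval ((r : ℂ) + t * ω) N * (conj ω ^ k * aeval ((r : ℂ) + t * conj ω) E)).im := by
    have h1 (P : ℝ[X]) (c : ℂ) : Continuous fun t : ℝ => aeval ((r : ℂ) + t * c) P :=
      P.continuous_aeval.comp (by fun_prop)
    exact Complex.continuous_im.comp ((h1 N ω).mul (continuous_const.mul (h1 E _)))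
  have ht := (hc.tendsto 0).mono_left (nhdsWithin_le_nhds (s := Ioi 0))
  have key := le_of_tendsto ht (b := 0) (by
    filter_upwards [self_mem_nhdsWithin] with t ht
    have ht : 0 < t := ht
    have h1 := h ((r : ℂ) + t * ω) (by simpa using mul_pos ht hω)
    have h2 : aeval ((r : ℂ) + t * ω) N * aeval (conj ((r : ℂ) + t * ω)) ((X - C r) ^ k * E) =
        ((t ^ k : ℝ) : ℂ) *
          (aeval ((r : ℂ) + t * ω) N * (conj ω ^ k * aeval ((r : ℂ) + t * conj ω) E)) := by
      simp [mul_pow]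
      ring
    rw [h2, Complex.im_ofReal_mul] at h1
    exact nonpos_of_mul_nonpos_right h1 (pow_pos ht k))
  simp only [Complex.ofReal_zero, zero_mul, add_zero, hr] at key
  rw [mul_left_comm, mul_comm, mul_comm, ← Complex.ofReal_mul, mul_comm,
    Complex.im_ofReal_mul] at key
  linarith

theorem MapsUpperToLower.eval_mul_eval_nonneg {N E : ℝ[X]} {r : ℝ}
    (h : MapsUpperToLower N ((X - C r) * E)) : 0 ≤ N.eval r * E.eval r := by
  have := MapsUpperToLower.local_im_nonpos (k := 1) (by simpa using h) (ω := Complex.I) (by simp)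
  simpa using this

theorem MapsUpperToLower.eval_eq_zero_of_multiple_root {N E : ℝ[X]} {r : ℝ} {k : ℕ} (hk : 2 ≤ k)
    (h : MapsUpperToLower N ((X - C r) ^ k * E)) (hE : E.eval r ≠ 0) : N.eval r = 0 := by
  have hk' : (2 : ℝ) ≤ k := by exact_mod_cast hk
  have hpow (a : ℝ) : conj (Complex.exp ((a / k : ℝ) * Complex.I)) ^ k =
      conj (Complex.exp (a * Complex.I)) := by
    rw [← map_pow, ← Complex.exp_nat_mul]
    congr 2
    have : (k : ℂ) ≠ 0 := by exact_mod_cast (by omega : k ≠ 0)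
    push_cast
    field_simp
  have him (a : ℝ) (h0 : 0 < a) (ha : a < 2 * Real.pi) :
      0 < (Complex.exp ((a / k : ℝ) * Complex.I)).im := by
    rw [Complex.exp_ofReal_mul_I_im]
    apply Real.sin_pos_of_pos_of_lt_pi (by positivity)
    rw [div_lt_iff₀ (by positivity)]
    nlinarith [Real.pi_pos]
  have h1 := h.local_im_nonpos (him (Real.pi / 2) (by positivity) (by linarith [Real.pi_pos]))
  have h2 := h.local_im_nonpos (him (Real.pi / 2 + Real.pi) (by positivity)
    (by linarith [Real.pi_pos]))
  rw [hpow, Complex.conj_im, Complex.exp_ofReal_mul_I_im] at h1 h2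
  rw [Real.sin_add_pi] at h2
  simp only [Real.sin_pi_div_two] at h1 h2
  have : N.eval r * E.eval r = 0 := by linarith
  exact (mul_eq_zero.1 this).resolve_right hE

theorem convexOn_inv_sub {r : ℝ} (hr : r < 0) : ConvexOn ℝ (Ici 0) fun x : ℝ => (x - r)⁻¹ := by
  have h := (convexOn_zpow (𝕜 := ℝ) (-1)).translate_left (-r)
  refine (h.subset (fun x hx => ?_) (convex_Ici 0)).congr fun x _ => ?_
  · simp only [mem_preimage, mem_Ioi]
    linarith [mem_Ici.1 hx]
  · simp [sub_eq_add_neg]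

/-- Partial fractions: a function with simple poles on the negative axis and nonnegative residues
is convex on the positive axis. -/
theorem MapsUpperToLower.convexOn_of_simple_roots {N D : ℝ[X]} (h : MapsUpperToLower N D)
    (hD0 : D ≠ 0) (hs : D.Splits) (hr : ∀ r ∈ D.roots, r < 0) (hdeg : N.degree ≤ D.degree)
    (hnd : D.roots.Nodup) : ConvexOn ℝ (Ici 0) fun x : ℝ => N.eval x / D.eval x := by
  classical
  set s := D.roots.toFinset with hs_def
  set a := D.leadingCoeff
  have ha : a ≠ 0 := leadingCoeff_ne_zero.2 hD0
  have hDs : D = C a * Lagrange.nodal s id := by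
    conv_lhs => rw [hs.eq_prod_roots]
    rw [Lagrange.nodal_eq, Finset.prod, hs_def, Multiset.toFinset_val, hnd.dedup]
    rfl
  have hcard : (s.card : WithBot ℕ) = D.degree := by
    rw [hs.degree_eq_card_roots hD0, hs_def, Multiset.toFinset_card_of_nodup hnd]
  obtain ⟨q, hq⟩ : ∃ q : ℝ, N / D = C q := by
    refine ⟨_, eq_C_of_degree_le_zero ?_⟩
    by_cases hlt : N.degree < D.degree
    · rw [(Polynomial.div_eq_zero_iff hD0).2 hlt]; simp
    · have h1 := degree_add_div hD0 (not_lt.1 hlt)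
      have h2 := h1.le.trans hdeg
      rw [degree_eq_natDegree hD0] at h2
      rcases hh : (N / D).degree with _ | n
      · exact bot_le
      · rw [hh] at h2
        have h3 : D.natDegree + n ≤ D.natDegree := WithBot.coe_le_coe.1 h2
        exact WithBot.coe_le_coe.2 (by omega)
  have hroot (r : ℝ) (hrs : r ∈ s) : r ∈ D.roots := Multiset.mem_toFinset.1 hrs
  have hrem : N % D = Lagrange.interpolate s id fun r => N.eval r := by
    apply Lagrange.eq_interpolate_of_eval_eq _ (injOn_id _)
    · rw [hcard]; exact EuclideanDomain.mod_lt N hD0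
    · intro r hrs
      have h1 := congrArg (eval r) (EuclideanDomain.div_add_mod N D)
      have h2 : D.eval r = 0 := (mem_roots'.1 (hroot r hrs)).2
      simpa [h2] using h1
  have hres (r : ℝ) (hrs : r ∈ s) : 0 ≤ a⁻¹ * (Lagrange.nodalWeight s id r * N.eval r) := by
    have h1 : D = (X - C r) * (C a * Lagrange.nodal (s.erase r) id) := by
      rw [mul_left_comm, hDs, Lagrange.nodal_eq_mul_nodal_erase hrs]
      simp
    have h2 := MapsUpperToLower.eval_mul_eval_nonneg (h1 ▸ h)
    have h3 : Lagrange.nodalWeight s id r = (eval r (Lagrange.nodal (s.erase r) id))⁻¹ :=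
      Lagrange.nodalWeight_eq_eval_nodal_erase_inv
    rw [eval_mul, eval_C] at h2
    rw [h3, ← mul_assoc, ← mul_inv, mul_comm, ← div_eq_mul_inv, ← mul_div_mul_right _ _ ?_]
    · exact div_nonneg h2 (mul_self_nonneg _)
    · have := Lagrange.nodalWeight_ne_zero (v := id) (injOn_id _) hrs
      rw [h3] at this
      exact mul_ne_zero ha (by simpa using this)
  have hf (x : ℝ) (hx : 0 ≤ x) : q + ∑ r ∈ s, a⁻¹ * (Lagrange.nodalWeight s id r * N.eval r) *
      (x - r)⁻¹ = N.eval x / D.eval x := by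
    have hxs : ∀ r ∈ s, x ≠ r := fun r hrs hxr => by linarith [hr r (hroot r hrs)]
    have hnod : eval x (Lagrange.nodal s id) ≠ 0 := Lagrange.eval_nodal_not_at_node hxs
    have h1 := congrArg (eval x) (EuclideanDomain.div_add_mod N D)
    have hDx : D.eval x = a * eval x (Lagrange.nodal s id) := by rw [hDs]; simp
    rw [hrem, eval_add, eval_mul, hq, eval_C,
      Lagrange.eval_interpolate_not_at_node (v := id) _ hxs, hDx] at h1
    have h2 (S : ℝ) : (a * eval x (Lagrange.nodal s id) * q + eval x (Lagrange.nodal s id) * S) /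
        (a * eval x (Lagrange.nodal s id)) = q + a⁻¹ * S := by
      field_simp
    rw [← h1, hDx, h2, Finset.mul_sum]
    congr 1
    exact Finset.sum_congr rfl fun r _ => by simp only [id]; ring
  refine ConvexOn.congr ?_ hf
  refine (convexOn_const q (convex_Ici 0)).add ?_
  have hsum (t : Finset ℝ) (ht : t ⊆ s) : ConvexOn ℝ (Ici 0) fun x : ℝ =>
      ∑ r ∈ t, a⁻¹ * (Lagrange.nodalWeight s id r * N.eval r) * (x - r)⁻¹ := by
    induction t using Finset.induction_on with
    | empty => simpa using convexOn_const (0 : ℝ) (convex_Ici 0)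
    | insert r t hrt ih =>
      simp only [Finset.sum_insert hrt]
      have hrs := ht (Finset.mem_insert_self r t)
      exact ((convexOn_inv_sub (hr r (hroot r hrs))).smul (hres r hrs)).add
        (ih ((Finset.subset_insert r t).trans ht))
  exact hsum s subset_rfl

theorem MapsUpperToLower.convexOn {N D : ℝ[X]} (h : MapsUpperToLower N D)
    (hD0 : D ≠ 0) (hs : D.Splits) (hr : ∀ r ∈ D.roots, r < 0) (hdeg : N.degree ≤ D.degree) :
    ConvexOn ℝ (Ici 0) fun x : ℝ => N.eval x / D.eval x := by
  induction hn : D.natDegree using Nat.strong_induction_on generalizing N D with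
  | _ n ih =>
  subst hn
  by_cases hnd : D.roots.Nodup
  · exact h.convexOn_of_simple_roots hD0 hs hr hdeg hnd
  classical
  obtain ⟨r, hr2⟩ : ∃ r, 2 ≤ D.roots.count r := by
    rw [Multiset.nodup_iff_count_le_one] at hnd
    push Not at hnd
    exact hnd
  rw [count_roots] at hr2
  obtain ⟨E, hE, hEr⟩ := exists_eq_pow_rootMultiplicity_mul_and_not_dvd D hD0 r
  have hN : N.eval r = 0 :=
    eval_eq_zero_of_multiple_root hr2 (hE ▸ h) fun h0 => hEr (dvd_iff_isRoot.2 h0)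
  have hrD : r ∈ D.roots := by
    rw [← Multiset.count_pos, count_roots]; omega
  have hr0 := hr r hrD
  obtain ⟨N₁, rfl⟩ := dvd_iff_isRoot.2 hN
  obtain ⟨D₁, rfl⟩ := dvd_iff_isRoot.2 (mem_roots'.1 hrD).2
  have hD1 : D₁ ≠ 0 := right_ne_zero_of_mul hD0
  have hlt : D₁.natDegree < ((X - C r) * D₁).natDegree := by
    rw [natDegree_mul (X_sub_C_ne_zero r) hD1, natDegree_X_sub_C]; omega
  have h1 : MapsUpperToLower N₁ D₁ := by
    intro z hz
    have h2 := h z hz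
    have h3 : aeval z ((X - C r) * N₁) * aeval (conj z) ((X - C r) * D₁) =
        ((Complex.normSq (z - r) : ℝ) : ℂ) * (aeval z N₁ * aeval (conj z) D₁) := by
      rw [Complex.normSq_eq_conj_mul_self]
      simp
      ring
    rw [h3, Complex.im_ofReal_mul] at h2
    refine nonpos_of_mul_nonpos_right h2 (Complex.normSq_pos.2 fun h0 => ?_)
    have := congrArg Complex.im h0
    simp at this
    exact hz.ne' this
  have hdeg1 : N₁.degree ≤ D₁.degree := by
    rw [degree_mul, degree_mul, degree_X_sub_C] at hdeg
    exact (WithBot.add_le_add_iff_left (by simp)).1 hdeg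
  refine (ih _ hlt h1 hD1 (splits_X_sub_C_mul_iff.1 hs) (fun y hy => hr y ?_) hdeg1 rfl).congr ?_
  · rw [roots_mul hD0]; exact Multiset.mem_add.2 (Or.inr hy)
  · intro x hx
    have : x - r ≠ 0 := by linarith [mem_Ici.1 hx]
    simp [mul_div_mul_left _ _ this]

theorem derivative_aeval_mvPolynomial {R A σ : Type*} [CommRing R] [CommRing A] [Algebra R A]
    [Fintype σ] (g : σ → A[X]) (p : MvPolynomial σ R) :
    derivative (MvPolynomial.aeval g p) =
      ∑ k, derivative (g k) * MvPolynomial.aeval g (MvPolynomial.pderiv k p) := by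
  classical
  induction p using MvPolynomial.induction_on with
  | C a => simp [IsScalarTower.algebraMap_apply R A A[X]]
  | add p q hp hq => simp [hp, hq, mul_add, Finset.sum_add_distrib]
  | mul_X p n hp =>
    simp only [map_mul, MvPolynomial.aeval_X, derivative_mul, hp, MvPolynomial.pderiv_mul,
      MvPolynomial.pderiv_X, map_add, mul_add, Finset.sum_add_distrib, Finset.sum_mul]
    congr 1
    · exact Finset.sum_congr rfl fun k _ => by ring
    · simp [Pi.single_apply, apply_ite, mul_comm]

/-- The restriction of a polynomial in several variables to the line `x ↦ w + x • u`. -/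
noncomputable def lineRestrict {σ : Type*} (p : MvPolynomial σ ℝ) (w u : σ → ℝ) : ℝ[X] :=
  MvPolynomial.aeval (fun k => C (w k) + C (u k) * X) p

theorem eval_lineRestrict {σ : Type*} (p : MvPolynomial σ ℝ) (w u : σ → ℝ) (x : ℝ) :
    (lineRestrict p w u).eval x = MvPolynomial.eval (w + x • u) p := by
  rw [lineRestrict, ← coe_aeval_eq_eval, MvPolynomial.comp_aeval_apply,
    MvPolynomial.aeval_eq_eval]
  refine congrArg (fun f => MvPolynomial.eval f p) (funext fun k => ?_)
  simp only [map_add, map_mul, aeval_C, aeval_X, Pi.add_apply, Pi.smul_apply, smul_eq_mul,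
    Algebra.algebraMap_self, RingHom.id_apply, mul_comm x]

theorem aeval_lineRestrict {σ : Type*} (p : MvPolynomial σ ℝ) (w u : σ → ℝ) (z : ℂ) :
    aeval z (lineRestrict p w u) = MvPolynomial.aeval (fun k => (w k : ℂ) + u k * z) p := by
  rw [lineRestrict, MvPolynomial.comp_aeval_apply]
  simp only [map_add, map_mul, aeval_C, aeval_X, Complex.coe_algebraMap]

theorem hasDerivAt_eval_line {σ : Type*} [Fintype σ] (p : MvPolynomial σ ℝ) (w u : σ → ℝ) (x : ℝ) :
    HasDerivAt (fun x : ℝ => MvPolynomial.eval (w + x • u) p)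
      (∑ k, u k * MvPolynomial.eval (w + x • u) (MvPolynomial.pderiv k p)) x := by
  have h := (lineRestrict p w u).hasDerivAt x
  simp only [eval_lineRestrict] at h
  refine h.congr_deriv ?_
  rw [lineRestrict, derivative_aeval_mvPolynomial, eval_finsetSum]
  refine Finset.sum_congr rfl fun k _ => ?_
  rw [eval_mul, ← eval_lineRestrict]
  simp [lineRestrict]

theorem RealStable.im_pderiv_mul_conj_nonpos {σ : Type*} [Fintype σ] {p : MvPolynomial σ ℝ}
    (hp : RealStable p) (i : σ) {ζ : σ → ℂ} (hζ : ∀ k, 0 < (ζ k).im) :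
    (MvPolynomial.aeval ζ (MvPolynomial.pderiv i p) * conj (MvPolynomial.aeval ζ p)).im ≤ 0 := by
  classical
  set g : σ → ℂ[X] := fun k => C (ζ k) + C (if k = i then 1 else 0) * X
  have hev (q : MvPolynomial σ ℝ) (y : ℂ) : (MvPolynomial.aeval g q).eval y =
      MvPolynomial.aeval (fun k => ζ k + (if k = i then 1 else 0) * y) q := by
    have h := MvPolynomial.comp_aeval_apply g ((aeval y : ℂ[X] →ₐ[ℂ] ℂ).restrictScalars ℝ) q
    simp only [AlgHom.restrictScalars_apply, coe_aeval_eq_eval] at h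
    rw [h]
    simp only [g, eval_add, eval_mul, eval_C, eval_X]
  have hev0 (q : MvPolynomial σ ℝ) :
      (MvPolynomial.aeval g q).eval 0 = MvPolynomial.aeval ζ q := by simp [hev]
  have hS0 : (MvPolynomial.aeval g p).eval 0 ≠ 0 := by rw [hev0]; exact hp ζ hζ
  have hder : (derivative (MvPolynomial.aeval g p)).eval 0 =
      MvPolynomial.aeval ζ (MvPolynomial.pderiv i p) := by
    rw [derivative_aeval_mvPolynomial, eval_finsetSum, Finset.sum_eq_single i]
    · rw [eval_mul, hev0]; simp [g]
    · intro k _ hk; simp [g, hk]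
    · simp
  have hsum := (IsAlgClosed.splits (MvPolynomial.aeval g p)).eval_derivative_eq_eval_mul_sum hS0
  rw [hder, hev0] at hsum
  have hroots : ∀ y ∈ (MvPolynomial.aeval g p).roots, y.im ≤ 0 := by
    intro y hy
    by_contra! hy0
    refine hp _ (fun k => ?_) ((hev p y).symm.trans (mem_roots'.1 hy).2)
    rw [Complex.add_im]
    split_ifs
    · simpa using add_pos (hζ k) hy0
    · simpa using hζ k
  have him (m : Multiset ℂ) (hm : ∀ y ∈ m, y.im ≤ 0) :
      ((m.map fun y => 1 / (0 - y)).sum).im ≤ 0 := by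
    induction m using Multiset.induction_on with
    | empty => simp
    | cons y m ih =>
      rw [Multiset.map_cons, Multiset.sum_cons, Complex.add_im]
      refine add_nonpos ?_ (ih fun y hy => hm y (Multiset.mem_cons_of_mem hy))
      rw [zero_sub, one_div, Complex.inv_im]
      have := hm y (Multiset.mem_cons_self y m)
      exact div_nonpos_of_nonpos_of_nonneg (by simpa using this) (Complex.normSq_nonneg _)
  rw [hsum, mul_right_comm, Complex.mul_conj, Complex.im_ofReal_mul]
  exact mul_nonpos_of_nonneg_of_nonpos (Complex.normSq_nonneg _) (him _ hroots)

theorem RealStable.aeval_lineRestrict_ne_zero {σ : Type*} {p : MvPolynomial σ ℝ}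
    (hp : RealStable p) (w : σ → ℝ) {u : σ → ℝ} (hu : ∀ k, 0 < u k) {z : ℂ} (hz : z.im ≠ 0) :
    aeval z (lineRestrict p w u) ≠ 0 := by
  have hpos (y : ℂ) (hy : 0 < y.im) : aeval y (lineRestrict p w u) ≠ 0 := by
    rw [aeval_lineRestrict]
    exact hp _ fun k => by simpa using mul_pos (hu k) hy
  rcases hz.lt_or_gt with hz | hz
  · intro h0
    refine hpos (conj z) (by simpa using hz) ?_
    rw [aeval_conj, h0, map_zero]
  · exact hpos z hz

theorem RealStable.splits_lineRestrict_s13 {σ : Type*} {p : MvPolynomial σ ℝ}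
    (hp : RealStable p) (w : σ → ℝ) {u : σ → ℝ} (hu : ∀ k, 0 < u k) :
    (lineRestrict p w u).Splits := by
  refine Splits.of_splits_map (algebraMap ℝ ℂ) (IsAlgClosed.splits _) fun a ha => ?_
  have h0 : aeval a (lineRestrict p w u) = 0 := by
    rw [aeval_def, ← eval_map]
    exact (mem_roots'.1 ha).2
  have him : a.im = 0 := by
    by_contra him
    exact hp.aeval_lineRestrict_ne_zero w hu him h0
  exact ⟨a.re, Complex.ext (by simp) (by simp [him])⟩

theorem RealStable.mapsUpperToLower {σ : Type*} [Fintype σ] {p : MvPolynomial σ ℝ}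
    (hp : RealStable p) (i : σ) (w : σ → ℝ) {u : σ → ℝ} (hu : ∀ k, 0 < u k) :
    MapsUpperToLower (lineRestrict (MvPolynomial.pderiv i p) w u) (lineRestrict p w u) := by
  intro z hz
  rw [aeval_conj, aeval_lineRestrict, aeval_lineRestrict]
  exact hp.im_pderiv_mul_conj_nonpos i fun k => by simpa using mul_pos (hu k) hz

theorem AboveRoots.add {σ : Type*} {p : MvPolynomial σ ℝ} {w t : σ → ℝ} (h : AboveRoots p w)
    (ht : ∀ k, 0 ≤ t k) : AboveRoots p (w + t) := fun s hs => by
  rw [add_assoc]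
  exact h _ fun k => add_nonneg (ht k) (hs k)

theorem AboveRoots.eval_pos {σ : Type*} {p : MvPolynomial σ ℝ} {w : σ → ℝ} (h : AboveRoots p w) :
    0 < MvPolynomial.eval w p := by
  simpa using h 0 fun _ => le_rfl

theorem AboveRoots.eval_lineRestrict_pos {σ : Type*} {p : MvPolynomial σ ℝ} {w u : σ → ℝ}
    (h : AboveRoots p w) (hu : ∀ k, 0 ≤ u k) {x : ℝ} (hx : 0 ≤ x) :
    0 < (lineRestrict p w u).eval x := by
  rw [eval_lineRestrict]
  exact h _ fun k => mul_nonneg hx (hu k)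

theorem AboveRoots.roots_lineRestrict_neg {σ : Type*} {p : MvPolynomial σ ℝ} {w u : σ → ℝ}
    (h : AboveRoots p w) (hu : ∀ k, 0 ≤ u k) : ∀ r ∈ (lineRestrict p w u).roots, r < 0 := by
  intro r hr
  by_contra! h0
  exact (h.eval_lineRestrict_pos hu h0).ne' (mem_roots'.1 hr).2

theorem tendsto_eval_perturb {σ : Type*} (p : MvPolynomial σ ℝ) (w u : σ → ℝ) (x : ℝ) :
    Tendsto (fun ε : ℝ => MvPolynomial.eval (w + x • (u + ε • (1 : σ → ℝ))) p) (𝓝[>] 0)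
      (𝓝 (MvPolynomial.eval (w + x • u) p)) := by
  have hc : Continuous fun ε : ℝ => MvPolynomial.eval (w + x • (u + ε • (1 : σ → ℝ))) p :=
    (MvPolynomial.continuous_eval p).comp (by fun_prop)
  simpa using (hc.tendsto 0).mono_left (nhdsWithin_le_nhds (s := Ioi 0))

theorem tendsto_barrier_perturb {σ : Type*} {p : MvPolynomial σ ℝ} (i : σ) {w u : σ → ℝ}
    (h : AboveRoots p w) (hu : ∀ k, 0 ≤ u k) {x : ℝ} (hx : 0 ≤ x) :
    Tendsto (fun ε : ℝ => barrier p i (w + x • (u + ε • (1 : σ → ℝ)))) (𝓝[>] 0)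
      (𝓝 (barrier p i (w + x • u))) :=
  (tendsto_eval_perturb _ w u x).div (tendsto_eval_perturb p w u x)
    (h.add (t := x • u) fun k => mul_nonneg hx (hu k)).eval_pos.ne'

theorem RealStable.barrier_nonneg {σ : Type*} [Fintype σ] {p : MvPolynomial σ ℝ}
    (hp : RealStable p) {w : σ → ℝ} (hw : AboveRoots p w) (i : σ) : 0 ≤ barrier p i w := by
  classical
  refine div_nonneg ?_ hw.eval_pos.le
  have hstrict (u : σ → ℝ) (hu : ∀ k, 0 < u k) :
      0 ≤ ∑ k, u k * MvPolynomial.eval w (MvPolynomial.pderiv k p) := by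
    have h1 := (hasDerivAt_eval_line p w u 0).unique
      ((funext fun x => eval_lineRestrict p w u x) ▸ (lineRestrict p w u).hasDerivAt 0)
    simp only [zero_smul, add_zero] at h1
    have h0 := hw.eval_lineRestrict_pos (fun k => (hu k).le) (le_refl (0 : ℝ))
    rw [h1, (hp.splits_lineRestrict_s13 w hu).eval_derivative_eq_eval_mul_sum h0.ne']
    refine mul_nonneg h0.le (Multiset.sum_nonneg fun y hy => ?_)
    obtain ⟨r, hr, rfl⟩ := Multiset.mem_map.1 hy
    have := hw.roots_lineRestrict_neg (fun k => (hu k).le) r hr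
    exact one_div_nonneg.2 (by linarith)
  have hc : Continuous fun ε : ℝ => ∑ k, ((Pi.single i 1 : σ → ℝ) k + ε) *
      MvPolynomial.eval w (MvPolynomial.pderiv k p) := by fun_prop
  have ht := (hc.tendsto 0).mono_left (nhdsWithin_le_nhds (s := Ioi 0))
  have key := ge_of_tendsto ht (b := 0) (by
    filter_upwards [self_mem_nhdsWithin] with ε hε
    refine hstrict _ fun k => add_pos_of_nonneg_of_pos ?_ hε
    rw [Pi.single_apply]; split_ifs <;> norm_num)
  simpa [Pi.single_apply] using key

theorem RealStable.barrier_line_of_pos {σ : Type*} [Fintype σ] {p : MvPolynomial σ ℝ}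
    (hp : RealStable p) {w : σ → ℝ} (hw : AboveRoots p w) (i : σ) {u : σ → ℝ}
    (hu : ∀ k, 0 < u k) :
    AntitoneOn (fun x : ℝ => barrier p i (w + x • u)) (Ici 0) ∧
      ConvexOn ℝ (Ici 0) (fun x : ℝ => barrier p i (w + x • u)) := by
  have hM := hp.mapsUpperToLower i w hu
  have hu' k := (hu k).le
  have hD (x : ℝ) (hx : 0 ≤ x) := (hw.eval_lineRestrict_pos hu' hx).ne'
  have hf : (fun x : ℝ => barrier p i (w + x • u)) = fun x : ℝ =>
      (lineRestrict (MvPolynomial.pderiv i p) w u).eval x / (lineRestrict p w u).eval x := by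
    simp only [eval_lineRestrict, barrier]
  have hnn (x : ℝ) (hx : 0 ≤ x) :
      0 ≤ (lineRestrict (MvPolynomial.pderiv i p) w u).eval x / (lineRestrict p w u).eval x := by
    rw [eval_lineRestrict, eval_lineRestrict]
    exact hp.barrier_nonneg (hw.add (t := x • u) fun k => mul_nonneg hx (hu' k)) i
  rw [hf]
  refine ⟨hM.antitoneOn hD, hM.convexOn (fun h0 => hD 0 le_rfl (by simp [h0]))
    (hp.splits_lineRestrict_s13 w hu) (hw.roots_lineRestrict_neg hu') (hM.degree_le hD hnn)⟩

theorem RealStable.antitoneOn_barrier_line {σ : Type*} [Fintype σ] {p : MvPolynomial σ ℝ}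
    (hp : RealStable p) {w : σ → ℝ} (hw : AboveRoots p w) (i : σ) {u : σ → ℝ}
    (hu : ∀ k, 0 ≤ u k) : AntitoneOn (fun x : ℝ => barrier p i (w + x • u)) (Ici 0) := by
  intro x hx y hy hxy
  refine le_of_tendsto_of_tendsto (tendsto_barrier_perturb i hw hu hy)
    (tendsto_barrier_perturb i hw hu hx) ?_
  filter_upwards [self_mem_nhdsWithin] with ε hε
  refine (hp.barrier_line_of_pos hw i fun k => ?_).1 hx hy hxy
  simpa using add_pos_of_nonneg_of_pos (hu k) hε

theorem RealStable.convexOn_barrier_line {σ : Type*} [Fintype σ] {p : MvPolynomial σ ℝ}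
    (hp : RealStable p) {w : σ → ℝ} (hw : AboveRoots p w) (i : σ) {u : σ → ℝ}
    (hu : ∀ k, 0 ≤ u k) : ConvexOn ℝ (Ici 0) (fun x : ℝ => barrier p i (w + x • u)) := by
  refine ⟨convex_Ici 0, fun x hx y hy a b ha hb hab => ?_⟩
  refine le_of_tendsto_of_tendsto
    (tendsto_barrier_perturb i hw hu (convex_Ici 0 hx hy ha hb hab))
    (((tendsto_barrier_perturb i hw hu hx).const_smul a).add
      ((tendsto_barrier_perturb i hw hu hy).const_smul b)) ?_
  filter_upwards [self_mem_nhdsWithin] with ε hε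
  refine (hp.barrier_line_of_pos hw i fun k => ?_).2.2 hx hy ha hb hab
  simpa using add_pos_of_nonneg_of_pos (hu k) hε

theorem RealStable.barrier_add_le {σ : Type*} [Fintype σ] {p : MvPolynomial σ ℝ}
    (hp : RealStable p) {w t : σ → ℝ} (hw : AboveRoots p w) (i : σ) (ht : ∀ k, 0 ≤ t k) :
    barrier p i (w + t) ≤ barrier p i w := by
  simpa using hp.antitoneOn_barrier_line hw i ht (mem_Ici.2 le_rfl)
    (mem_Ici.2 zero_le_one) zero_le_one

theorem MvPolynomial.pderiv_comm {R σ : Type*} [CommRing R] (i j : σ) (p : MvPolynomial σ R) :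
    pderiv i (pderiv j p) = pderiv j (pderiv i p) := by
  classical
  have h : ⁅(pderiv i : Derivation R (MvPolynomial σ R) (MvPolynomial σ R)),
      (pderiv j : Derivation R (MvPolynomial σ R) (MvPolynomial σ R))⁆ = 0 := by
    refine MvPolynomial.derivation_ext fun k => ?_
    simp only [Derivation.commutator_apply, pderiv_X, Pi.single_apply]
    split_ifs <;> simp
  have h1 := congrArg (fun D : Derivation R (MvPolynomial σ R) (MvPolynomial σ R) => D p) h
  simpa only [Derivation.commutator_apply, Derivation.coe_zero, Pi.zero_apply, sub_eq_zero] using h1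

theorem hasDerivAt_eval_add_smul_single {σ : Type*} [Fintype σ] [DecidableEq σ]
    (p : MvPolynomial σ ℝ) (w : σ → ℝ) (j : σ) (x : ℝ) :
    HasDerivAt (fun x : ℝ => MvPolynomial.eval (w + x • (Pi.single j 1 : σ → ℝ)) p)
      (MvPolynomial.eval (w + x • (Pi.single j 1 : σ → ℝ)) (MvPolynomial.pderiv j p)) x := by
  refine (hasDerivAt_eval_line p w _ x).congr_deriv ?_
  simp [Pi.single_apply]

theorem hasDerivAt_eval_div {σ : Type*} [Fintype σ] [DecidableEq σ] (q : MvPolynomial σ ℝ)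
    {p : MvPolynomial σ ℝ} {w : σ → ℝ} (j : σ) {x : ℝ}
    (h : MvPolynomial.eval (w + x • (Pi.single j 1 : σ → ℝ)) p ≠ 0) :
    HasDerivAt (fun x : ℝ => MvPolynomial.eval (w + x • (Pi.single j 1 : σ → ℝ)) q /
        MvPolynomial.eval (w + x • (Pi.single j 1 : σ → ℝ)) p)
      (MvPolynomial.eval (w + x • (Pi.single j 1 : σ → ℝ)) (MvPolynomial.pderiv j q) /
          MvPolynomial.eval (w + x • (Pi.single j 1 : σ → ℝ)) p -
        MvPolynomial.eval (w + x • (Pi.single j 1 : σ → ℝ)) q /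
          MvPolynomial.eval (w + x • (Pi.single j 1 : σ → ℝ)) p *
            barrier p j (w + x • (Pi.single j 1 : σ → ℝ))) x := by
  refine ((hasDerivAt_eval_add_smul_single q w j x).fun_div
    (hasDerivAt_eval_add_smul_single p w j x) h).congr_deriv ?_
  rw [barrier]
  field_simp

/-- Monotonicity and convexity of the barrier function `Φ^i` in direction `j`, in terms of
derivatives at the point `w = z + δ e_j`, together with the tangent line inequality at `w`. -/
theorem RealStable.barrier_derivative_bounds {σ : Type*} [Fintype σ] [DecidableEq σ]
    {p : MvPolynomial σ ℝ} (hp : RealStable p) {z : σ → ℝ} (hz : AboveRoots p z) (i j : σ)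
    {δ : ℝ} (hδ : 0 < δ) {w : σ → ℝ} (hw : w = z + δ • (Pi.single j 1 : σ → ℝ))
    {m l s : ℝ}
    (hm : m = MvPolynomial.eval w (MvPolynomial.pderiv j (MvPolynomial.pderiv i p)) /
      MvPolynomial.eval w p)
    (hl : l = MvPolynomial.eval w
      (MvPolynomial.pderiv j (MvPolynomial.pderiv j (MvPolynomial.pderiv i p))) /
        MvPolynomial.eval w p)
    (hs : s = MvPolynomial.eval w (MvPolynomial.pderiv j (MvPolynomial.pderiv j p)) /
      MvPolynomial.eval w p) :
    m - barrier p i w * barrier p j w ≤ 0 ∧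
      0 ≤ l - barrier p i w * s - 2 * barrier p j w * (m - barrier p i w * barrier p j w) ∧
      barrier p i w - δ * (m - barrier p i w * barrier p j w) ≤ barrier p i z := by
  have he : ∀ k, 0 ≤ (Pi.single j 1 : σ → ℝ) k := fun k => by
    rw [Pi.single_apply]; split_ifs <;> norm_num
  have hP (x : ℝ) (hx : 0 ≤ x) :
      MvPolynomial.eval (z + x • (Pi.single j 1 : σ → ℝ)) p ≠ 0 :=
    (hz.add (t := x • Pi.single j 1) fun k => mul_nonneg hx (he k)).eval_pos.ne'
  have hanti := hp.antitoneOn_barrier_line hz i he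
  have hconv := hp.convexOn_barrier_line hz i he
  have hd1 (k : σ) (x : ℝ) (hx : 0 < x) :
      HasDerivAt (fun x : ℝ => barrier p k (z + x • (Pi.single j 1 : σ → ℝ)))
        (MvPolynomial.eval (z + x • (Pi.single j 1 : σ → ℝ))
            (MvPolynomial.pderiv j (MvPolynomial.pderiv k p)) /
          MvPolynomial.eval (z + x • (Pi.single j 1 : σ → ℝ)) p -
        barrier p k (z + x • (Pi.single j 1 : σ → ℝ)) *
          barrier p j (z + x • (Pi.single j 1 : σ → ℝ))) x :=
    hasDerivAt_eval_div (MvPolynomial.pderiv k p) j (hP x hx.le)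
  have hd2 := (hasDerivAt_eval_div (MvPolynomial.pderiv j (MvPolynomial.pderiv i p)) j
    (hP δ hδ.le)).fun_sub ((hd1 i δ hδ).fun_mul (hd1 j δ hδ))
  have hslope := hconv.slope_le_of_hasDerivAt (mem_Ici.2 le_rfl) (mem_Ici.2 hδ.le) hδ (hd1 i δ hδ)
  have hnonpos := (hanti.mono Ioi_subset_Ici_self).derivWithin_nonpos (x := δ)
  have hmono := (hconv.subset Ioi_subset_Ici_self (convex_Ioi 0)).monotoneOn_deriv
    fun x hx => (hd1 i x hx).differentiableAt
  have hmono' := (hmono.congr fun x hx => (hd1 i x hx).deriv).derivWithin_nonneg (x := δ)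
  rw [derivWithin_of_isOpen isOpen_Ioi hδ] at hnonpos hmono'
  rw [(hd1 i δ hδ).deriv, ← hw, ← hm] at hnonpos
  rw [hd2.deriv] at hmono'
  simp only [← hw, ← hm, ← hl, ← hs] at hmono'
  refine ⟨hnonpos, hmono'.trans_eq (by ring), ?_⟩
  rw [slope_def_field, div_le_iff₀ (by linarith)] at hslope
  simp only [← hw, ← hm, zero_smul, add_zero, sub_zero] at hslope
  linarith

theorem barrier_shift_arithmetic {a b c δ l m s : ℝ} (hδ : 0 < δ) (hb : 0 ≤ b)
    (hm : m - a * b ≤ 0) (hl : 0 ≤ l - a * s - 2 * b * (m - a * b)) (hs : s ≤ b ^ 2)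
    (hc : c ^ 2 * (2 / δ * b + b ^ 2) ≤ 1) :
    0 < 1 - c ^ 2 * s ∧ (a - c ^ 2 * l) / (1 - c ^ 2 * s) ≤ a - δ * (m - a * b) := by
  have h1 : 2 * c ^ 2 * b + δ * (c ^ 2 * b ^ 2) ≤ δ := by
    have h := mul_le_mul_of_nonneg_left hc hδ.le
    have h2 : δ * (c ^ 2 * (2 / δ * b + b ^ 2)) = 2 * c ^ 2 * b + δ * (c ^ 2 * b ^ 2) := by
      field_simp
    linarith
  have h2 : c ^ 2 * s ≤ c ^ 2 * b ^ 2 := mul_le_mul_of_nonneg_left hs (sq_nonneg c)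
  have hpos : 0 < 1 - c ^ 2 * s := by
    rcases (mul_nonneg (sq_nonneg c) hb).eq_or_lt with h0 | h0
    · have : c ^ 2 * b ^ 2 = 0 := by rw [sq b, ← mul_assoc, ← h0, zero_mul]
      linarith
    · have : δ * (c ^ 2 * b ^ 2) < δ * 1 := by linarith
      linarith [lt_of_mul_lt_mul_left this hδ.le]
  refine ⟨hpos, (div_le_iff₀ hpos).2 ?_⟩
  have h3 : 2 * c ^ 2 * b ≤ δ * (1 - c ^ 2 * s) := by
    linarith [mul_le_mul_of_nonneg_left h2 hδ.le]
  have h4 := mul_le_mul_of_nonpos_right h3 hm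
  have h5 := mul_nonneg (sq_nonneg c) hl
  linarith

/-- The barrier shift lemma at a single point, together with positivity of the new polynomial. -/
theorem RealStable.barrier_shift {σ : Type*} [Fintype σ] [DecidableEq σ]
    {p : MvPolynomial σ ℝ} (hp : RealStable p) (c : ℝ) {z : σ → ℝ} (hz : AboveRoots p z) (i j : σ)
    {δ : ℝ} (hδ : 0 < δ)
    (hbar : c ^ 2 * ((2 / δ) * barrier p j z + (barrier p j z) ^ 2) ≤ 1) :
    0 < MvPolynomial.eval (z + δ • (Pi.single j 1 : σ → ℝ))
        (p - c ^ 2 • MvPolynomial.pderiv j (MvPolynomial.pderiv j p)) ∧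
      barrier (p - c ^ 2 • MvPolynomial.pderiv j (MvPolynomial.pderiv j p)) i
        (z + δ • (Pi.single j 1 : σ → ℝ)) ≤ barrier p i z := by
  have he : ∀ k, 0 ≤ (δ • (Pi.single j 1 : σ → ℝ)) k := fun k => by
    rw [Pi.smul_apply, Pi.single_apply]
    split_ifs <;> simp [hδ.le]
  obtain ⟨h1, h2, h3⟩ := hp.barrier_derivative_bounds hz i j hδ rfl rfl rfl rfl
  obtain ⟨hs, -, -⟩ := hp.barrier_derivative_bounds hz j j hδ rfl rfl rfl rfl
  have hle := hp.barrier_add_le hz j he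
  have hnn := hp.barrier_nonneg (hz.add he) j
  have hP := (hz.add he).eval_pos
  set w := z + δ • (Pi.single j 1 : σ → ℝ)
  have hbarw : c ^ 2 * ((2 / δ) * barrier p j w + (barrier p j w) ^ 2) ≤ 1 := by
    refine le_trans ?_ hbar
    gcongr
  obtain ⟨hpos, hq⟩ := barrier_shift_arithmetic hδ hnn h1 h2 (by linarith) hbarw
  constructor
  · have h := mul_pos hP hpos
    rw [mul_sub, mul_one, mul_left_comm, mul_div_cancel₀ _ hP.ne'] at h
    simpa using h
  · refine le_trans (le_of_eq ?_) (hq.trans h3)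
    have hcomm : MvPolynomial.pderiv i (MvPolynomial.pderiv j (MvPolynomial.pderiv j p)) =
        MvPolynomial.pderiv j (MvPolynomial.pderiv j (MvPolynomial.pderiv i p)) := by
      rw [MvPolynomial.pderiv_comm i j, MvPolynomial.pderiv_comm i j p]
    have hN (x y : ℝ) : x / MvPolynomial.eval w p - c ^ 2 * (y / MvPolynomial.eval w p) =
        (x - c ^ 2 * y) / MvPolynomial.eval w p := by ring
    rw [← div_self hP.ne']
    simp only [barrier, map_sub, Derivation.map_smul, MvPolynomial.smul_eval, hcomm, hN]
    rw [div_div_div_cancel_right₀ hP.ne']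

end

/-- the barrier shift lemma for the operator `1 − c²∂²_{z_j}`
(Lemma `AG`, after Anari–Oveis Gharan and Kyng–Luh–Song). -/
theorem statement13 {m : ℕ} (p : MvPolynomial (Fin m) ℝ) (hp : RealStable p)
    (c : ℝ) (hc : 0 ≤ c) (z : Fin m → ℝ) (hz : AboveRoots p z)
    (j : Fin m) (δ : ℝ) (hδ : 0 < δ)
    (hbar : c ^ 2 * ((2 / δ) * barrier p j z + (barrier p j z) ^ 2) ≤ 1) :
    AboveRoots (p - c ^ 2 • MvPolynomial.pderiv j (MvPolynomial.pderiv j p))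
      (z + δ • (Pi.single j 1 : Fin m → ℝ)) ∧
    ∀ i : Fin m,
      barrier (p - c ^ 2 • MvPolynomial.pderiv j (MvPolynomial.pderiv j p)) i
          (z + δ • (Pi.single j 1 : Fin m → ℝ)) ≤
        barrier p i z := by
  refine ⟨fun t ht => ?_, fun i => (hp.barrier_shift c hz i j hδ hbar).2⟩
  have hle := hp.barrier_add_le hz j ht
  have hnn := hp.barrier_nonneg (hz.add ht) j
  rw [add_right_comm]
  refine (hp.barrier_shift c (hz.add ht) j j hδ (le_trans ?_ hbar)).1
  gcongr
end
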